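/- There is a universal constant C' > 0 such that: if K ⊂ ℝⁿ is a p-convex body with constant α which is isotropic with isotropic constant L_K, and q := p/(p−1), then for every volume-preserving linear map T ∈ SL(n,ℝ), (Var^q_{T(K)}(|x|²))^{1/q} ≤ C' (α n)^{−1/p} n^{3/4} M*(T*T(K)) L_K, where T* is the adjoint of T. -/

import Mathlib

open MeasureTheory Real Set
open scoped ENNReal RealInnerProductSpace Pointwise

noncomputable section

namespace GM

abbrev E (n : ℕ) := EuclideanSpace ℝ (Fin n)

variable {n : ℕ}

/-- A centrally-symmetric convex body. -/
def IsConvexBody (K : Set (E n)) : Prop :=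
  IsCompact K ∧ Convex ℝ K ∧ (interior K).Nonempty ∧ K = -K

/-- The Euclidean unit sphere in `E n`. -/
def usphere (n : ℕ) : Set (E n) := Metric.sphere 0 1

/-- Haar probability measure on the unit sphere, realized as the normalized
`(n-1)`-dimensional Hausdorff measure restricted to the sphere. -/
def sphMeasure (n : ℕ) : Measure (E n) :=
  (μH[(n : ℝ) - 1] (usphere n))⁻¹ • (μH[(n : ℝ) - 1]).restrict (usphere n)

/-- The marginal density `g_θ(s) = vol_{n-1}(K ∩ {sθ + θ^⊥})`. -/
def gdens (K : Set (E n)) (θ : E n) (s : ℝ) : ℝ :=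
  (μH[(n : ℝ) - 1] (K ∩ {x : E n | ⟪x, θ⟫ = s})).toReal

/-- The centered Gaussian density with variance `ρ²`. -/
def gauss (ρ s : ℝ) : ℝ :=
  (Real.sqrt (2 * π) * ρ)⁻¹ * Real.exp (-(s ^ 2) / (2 * ρ ^ 2))

/-- Kolmogorov-type distance between even densities. -/
def dKol (f₁ f₂ : ℝ → ℝ) : ℝ :=
  sSup {d | ∃ t > (0 : ℝ), d = |(∫ s in (-t)..t, f₁ s) - ∫ s in (-t)..t, f₂ s|}

/-- Linnik-type distance between densities. -/
def dLin (T : ℝ) (f₁ f₂ : ℝ → ℝ) : ℝ :=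
  sSup {d | ∃ s : ℝ, 0 ≤ s ∧ s ≤ T ∧ d = |f₁ s / f₂ s - 1|}

/-- `ρ_θ = (∫_K ⟨x,θ⟩² dx)^{1/2}`. -/
def rhoDir (K : Set (E n)) (θ : E n) : ℝ :=
  Real.sqrt (∫ x in K, ⟪x, θ⟫ ^ 2)

def rhoMax (K : Set (E n)) : ℝ := sSup (rhoDir K '' usphere n)

def rhoAvg (K : Set (E n)) : ℝ := ∫ θ, rhoDir K θ ∂(sphMeasure n)

/-- `C_iso(K) = ρ_max / ρ_avg`. -/
def Ciso (K : Set (E n)) : ℝ := rhoMax K / rhoAvg K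

/-- Concentration hypothesis (⋆) with parameters `(ρ, A, B, ν, τ)`. -/
def ConcHyp (K : Set (E n)) (ρ A B ν τ : ℝ) : Prop :=
  ∀ t : ℝ, 0 ≤ t → t ≤ 1 →
    volume {x : E n | x ∈ K ∧ t * ρ ≤ |‖x‖ / Real.sqrt n - ρ|} ≤
      ENNReal.ofReal (A * Real.exp (-B * (n : ℝ) ^ ν * t ^ τ))

/-- The modulus of convexity of `K` (w.r.t. the gauge norm of `K`). -/
def modConv (K : Set (E n)) (ε : ℝ) : ℝ :=
  sInf {d | ∃ x y : E n, gauge K x ≤ 1 ∧ gauge K y ≤ 1 ∧ ε ≤ gauge K (x - y) ∧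
    d = 1 - gauge K ((2⁻¹ : ℝ) • (x + y))}

/-- `K` is a `p`-convex body with constant `α`. -/
def IsPConvexBody (K : Set (E n)) (p α : ℝ) : Prop :=
  IsConvexBody K ∧ ∀ ε : ℝ, 0 < ε → ε ≤ 2 → α * ε ^ p ≤ modConv K ε

/-- Löwner's minimal diameter position. -/
def IsLowner (K : Set (E n)) : Prop :=
  ∀ T : E n →ₗ[ℝ] E n, |LinearMap.det T| = 1 →
    Metric.diam K ≤ Metric.diam (T '' K)

/-- The type-`s` constant of `X_K = (ℝⁿ, ‖·‖_K)`. -/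
def typeConst (K : Set (E n)) (s : ℝ) : ℝ :=
  sInf {T : ℝ | 0 < T ∧ ∀ m : ℕ, ∀ x : Fin m → E n,
    Real.sqrt (((2 : ℝ) ^ m)⁻¹ * ∑ ε : Fin m → Bool,
      gauge K (∑ i, (if ε i then (1 : ℝ) else -1) • x i) ^ 2) ≤
      T * (∑ i, gauge K (x i) ^ s) ^ (1 / s)}

/-- `X_K` is (isometric to) a subspace of a quotient of `L_p([0,1])`:
there is a closed submodule `N` of `L_p([0,1])` and a linear isometric embedding of
`(ℝⁿ, ‖·‖_K)` into the quotient `L_p([0,1]) ⧸ N` (with the quotient norm). -/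
def IsSubspaceOfQuotientOfLp (K : Set (E n)) (p : ℝ) (hp : 1 ≤ p) : Prop :=
  letI : Fact ((1 : ℝ≥0∞) ≤ ENNReal.ofReal p) := ⟨ENNReal.one_le_ofReal.mpr hp⟩
  ∃ N : Submodule ℝ (MeasureTheory.Lp ℝ (ENNReal.ofReal p) (volume.restrict (Icc (0 : ℝ) 1))),
    IsClosed (N : Set (MeasureTheory.Lp ℝ (ENNReal.ofReal p) (volume.restrict (Icc (0 : ℝ) 1)))) ∧
    ∃ J : E n →ₗ[ℝ]
      (MeasureTheory.Lp ℝ (ENNReal.ofReal p) (volume.restrict (Icc (0 : ℝ) 1)) ⧸ N),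
      ∀ x : E n, gauge K x = ‖J x‖

/-- `K` is isotropic with isotropic constant `L`. -/
def IsIsotropic (K : Set (E n)) (L : ℝ) : Prop :=
  volume K = 1 ∧ ∀ θ : E n, ‖θ‖ = 1 → (∫ x in K, ⟪x, θ⟫ ^ 2) = L ^ 2

/-- Entropy of `g` over `K`. -/
def entK (K : Set (E n)) (g : E n → ℝ) : ℝ :=
  (∫ x in K, g x * Real.log (g x)) - (∫ x in K, g x) * Real.log (∫ x in K, g x)

/-- `Var^q_K(f) = ∫_K |f - ∫_K f|^q`. -/
def varq (K : Set (E n)) (q : ℝ) (f : E n → ℝ) : ℝ :=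
  ∫ x in K, |f x - ∫ y in K, f y| ^ q

/-- The dual gauge `‖y‖_K^* = sup_{x ∈ K} ⟨x,y⟩`. -/
def dualGauge (K : Set (E n)) (y : E n) : ℝ :=
  sSup ((fun x : E n => ⟪x, y⟫) '' K)

/-- Half the mean width `M*(K)`. -/
def Mstar (K : Set (E n)) : ℝ := ∫ θ, dualGauge K θ ∂(sphMeasure n)

/-- Minimal mean-width position. -/
def IsMinMeanWidth (K : Set (E n)) : Prop :=
  ∀ T : E n →ₗ[ℝ] E n, |LinearMap.det T| = 1 → Mstar K ≤ Mstar (T '' K)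

/-- Positive definite symmetric linear map. -/
def IsPosDef (T : E n →ₗ[ℝ] E n) : Prop :=
  LinearMap.IsSymmetric T ∧ ∀ x : E n, x ≠ 0 → 0 < ⟪T x, x⟫

/-- Operator norm (w.r.t. the Euclidean norm). -/
def opNorm (T : E n →ₗ[ℝ] E n) : ℝ := ‖LinearMap.toContinuousLinearMap T‖

lemma bm1_compact (A B : Set ℝ) (hA : IsCompact A) (hB : IsCompact B) (hAn : A.Nonempty)
    (hBn : B.Nonempty) : volume A + volume B ≤ volume (A + B) := by
  obtain ⟨a, ha, hamax⟩ := hA.exists_isGreatest hAn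
  obtain ⟨b, hb, hbmin⟩ := hB.exists_isLeast hBn
  have h1 : volume ((fun x => x + b) '' A) = volume A := by
    rw [Set.image_add_right]; exact measure_preimage_add_right _ _ _
  have h2 : volume ((fun x => a + x) '' B) = volume B := by
    rw [Set.image_add_left]; exact measure_preimage_add _ _ _
  have hd : AEDisjoint volume ((fun x => x + b) '' A) ((fun x => a + x) '' B) := by
    refine measure_mono_null (t := {a + b}) ?_ (by simp)
    rintro z ⟨⟨x, hx, rfl⟩, ⟨y, hy, hxy⟩⟩
    have := hamax hx
    have := hbmin hy
    simp only [Set.mem_singleton_iff] at *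
    linarith
  rw [← h1, ← h2, ← measure_union₀ ?_ hd]
  · apply measure_mono
    rintro z (⟨x, hx, rfl⟩ | ⟨x, hx, rfl⟩)
    · exact Set.add_mem_add hx hb
    · exact Set.add_mem_add ha hx
  · exact ((hB.image (by fun_prop)).measurableSet).nullMeasurableSet

lemma bm1 (A B C : Set ℝ) (hA : MeasurableSet A) (hB : MeasurableSet B) (hAn : A.Nonempty)
    (hBn : B.Nonempty) (hC : ∀ a ∈ A, ∀ b ∈ B, (a + b) / 2 ∈ C) :
    volume A + volume B ≤ 2 * volume C := by
  have hC2 : volume ((2 : ℝ) • C) = 2 * volume C := by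
    rw [Measure.addHaar_smul]; simp
  rw [← hC2]
  obtain ⟨a0, ha0⟩ := hAn
  obtain ⟨b0, hb0⟩ := hBn
  have key : ∀ r < volume A, ∀ s < volume B, r + s ≤ volume ((2 : ℝ) • C) := by
    intro r hr s hs
    obtain ⟨K, hKA, hK, hrK⟩ := hA.exists_lt_isCompact hr
    obtain ⟨K', hKB, hK', hsK⟩ := hB.exists_lt_isCompact hs
    have h1 := bm1_compact (insert a0 K) (insert b0 K') (hK.insert _) (hK'.insert _)
      (Set.insert_nonempty _ _) (Set.insert_nonempty _ _)
    have h2 : insert a0 K + insert b0 K' ⊆ (2 : ℝ) • C := by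
      rintro _ ⟨x, hx, y, hy, rfl⟩
      have hx' : x ∈ A := (Set.insert_subset ha0 hKA) hx
      have hy' : y ∈ B := (Set.insert_subset hb0 hKB) hy
      refine ⟨_, hC x hx' y hy', ?_⟩
      simp only [smul_eq_mul]; ring
    calc r + s ≤ volume (insert a0 K) + volume (insert b0 K') := 
          add_le_add (hrK.le.trans (measure_mono (Set.subset_insert _ _)))
            (hsK.le.trans (measure_mono (Set.subset_insert _ _)))
      _ ≤ _ := h1.trans (measure_mono h2)
  have hA0 : volume A ≤ volume ((2 : ℝ) • C) := by
    have : volume ((fun x => x + b0) '' A) = volume A := by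
      rw [Set.image_add_right]; exact measure_preimage_add_right _ _ _
    rw [← this]
    apply measure_mono
    rintro _ ⟨x, hx, rfl⟩
    exact ⟨_, hC x hx b0 hb0, by simp only [smul_eq_mul]; ring⟩
  have hB0 : volume B ≤ volume ((2 : ℝ) • C) := by
    have : volume ((fun x => a0 + x) '' B) = volume B := by
      rw [Set.image_add_left]; exact measure_preimage_add _ _ _
    rw [← this]
    apply measure_mono
    rintro _ ⟨x, hx, rfl⟩
    exact ⟨_, hC a0 ha0 x hx, by simp only [smul_eq_mul]; ring⟩
  rcases eq_or_ne (volume A) 0 with h | h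
  · rw [h, zero_add]; exact hB0
  rcases eq_or_ne (volume B) 0 with h' | h'
  · rw [h', add_zero]; exact hA0
  by_contra hcon
  push Not at hcon
  obtain ⟨r, hr, s, hs, hrs⟩ := ENNReal.exists_lt_add_of_lt_add hcon h h'
  exact absurd (key r hr s hs) (not_le.mpr hrs)

lemma pl1_norm (f g h : ℝ → ℝ) (hf : Measurable f) (hg : Measurable g) (hh : Measurable h)
    (f0 : ∀ x, 0 ≤ f x) (g0 : ∀ x, 0 ≤ g x) (h0 : ∀ x, 0 ≤ h x)
    (f1 : ∀ x, f x ≤ 1) (g1 : ∀ x, g x ≤ 1)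
    (fs : ∀ t < 1, ∃ x, t < f x) (gs : ∀ t < 1, ∃ x, t < g x)
    (H : ∀ x y, f x * g y ≤ h ((x + y) / 2) ^ 2) :
    (∫⁻ x, ENNReal.ofReal (f x)) + (∫⁻ x, ENNReal.ofReal (g x)) ≤
      2 * ∫⁻ x, ENNReal.ofReal (h x) := by
  rw [lintegral_eq_lintegral_meas_lt _ (Filter.Eventually.of_forall f0) hf.aemeasurable,
    lintegral_eq_lintegral_meas_lt _ (Filter.Eventually.of_forall g0) hg.aemeasurable,
    lintegral_eq_lintegral_meas_lt _ (Filter.Eventually.of_forall h0) hh.aemeasurable]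
  have anti : ∀ u : ℝ → ℝ, Antitone (fun t : ℝ => volume {a : ℝ | t < u a}) := by
    intro u s t hst
    exact measure_mono (fun x hx => lt_of_le_of_lt hst hx)
  rw [← lintegral_add_left ((anti f).measurable), ← lintegral_const_mul _ ((anti h).measurable)]
  refine setLIntegral_mono' measurableSet_Ioi ?_
  intro t ht
  simp only [Set.mem_Ioi] at ht
  rcases lt_or_ge t 1 with ht1 | ht1
  · refine bm1 _ _ _ (measurableSet_lt measurable_const hf)
      (measurableSet_lt measurable_const hg) (fs t ht1) (gs t ht1) ?_
    intro a ha b hb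
    simp only [Set.mem_ofPred_eq] at *
    have := H a b
    have : t ^ 2 < h ((a + b) / 2) ^ 2 := by nlinarith
    exact lt_of_pow_lt_pow_left₀ 2 (h0 _) this
  · have e1 : {a : ℝ | t < f a} = ∅ := by
      ext x; simp only [Set.mem_ofPred_eq, Set.mem_empty_iff_false, iff_false, not_lt]
      exact (f1 x).trans ht1
    have e2 : {a : ℝ | t < g a} = ∅ := by
      ext x; simp only [Set.mem_ofPred_eq, Set.mem_empty_iff_false, iff_false, not_lt]
      exact (g1 x).trans ht1
    simp [e1, e2]

lemma ennreal_amgm (x y z : ℝ≥0∞) (h : x + y ≤ 2 * z) : x * y ≤ z ^ 2 := by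
  rcases eq_or_ne z ∞ with rfl | hz
  · simp
  have h2 : x + y ≠ ∞ := ne_top_of_le_ne_top (ENNReal.mul_ne_top (by simp) hz) h
  have hx : x ≠ ∞ := fun h => h2 (by simp [h])
  have hy : y ≠ ∞ := fun h => h2 (by simp [h])
  lift x to NNReal using hx
  lift y to NNReal using hy
  lift z to NNReal using hz
  norm_cast at *
  have h' : (x : ℝ) + y ≤ 2 * z := by exact_mod_cast h
  have : (x : ℝ) * y ≤ z ^ 2 := by nlinarith [sq_nonneg ((x : ℝ) - y), x.2, y.2, z.2]
  exact_mod_cast this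

lemma pl1_bdd (f g h : ℝ → ℝ) (hf : Measurable f) (hg : Measurable g) (hh : Measurable h)
    (f0 : ∀ x, 0 ≤ f x) (g0 : ∀ x, 0 ≤ g x) (h0 : ∀ x, 0 ≤ h x) (N : ℝ)
    (f1 : ∀ x, f x ≤ N) (g1 : ∀ x, g x ≤ N)
    (H : ∀ x y, f x * g y ≤ h ((x + y) / 2) ^ 2) :
    (∫⁻ x, ENNReal.ofReal (f x)) * (∫⁻ x, ENNReal.ofReal (g x)) ≤
      (∫⁻ x, ENNReal.ofReal (h x)) ^ 2 := by
  have bf : BddAbove (Set.range f) := ⟨N, by rintro _ ⟨x, rfl⟩; exact f1 x⟩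
  have bg : BddAbove (Set.range g) := ⟨N, by rintro _ ⟨x, rfl⟩; exact g1 x⟩
  set a := ⨆ x, f x with ha
  set b := ⨆ x, g x with hb
  have fa : ∀ x, f x ≤ a := fun x => le_ciSup bf x
  have gb : ∀ x, g x ≤ b := fun x => le_ciSup bg x
  rcases (show 0 ≤ a from (f0 0).trans (fa 0)).eq_or_lt with ha0 | ha0
  · have : ∀ x, f x = 0 := fun x => le_antisymm (ha0 ▸ fa x) (f0 x)
    simp [this]
  rcases (show 0 ≤ b from (g0 0).trans (gb 0)).eq_or_lt with hb0 | hb0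
  · have : ∀ x, g x = 0 := fun x => le_antisymm (hb0 ▸ gb x) (g0 x)
    simp [this]
  have hab : 0 < a * b := mul_pos ha0 hb0
  have key := pl1_norm (fun x => f x / a) (fun x => g x / b) (fun x => h x / Real.sqrt (a * b))
    (hf.div_const _) (hg.div_const _) (hh.div_const _) (fun x => div_nonneg (f0 x) ha0.le)
    (fun x => div_nonneg (g0 x) hb0.le) (fun x => div_nonneg (h0 x) (Real.sqrt_nonneg _))
    (fun x => (div_le_one ha0).2 (fa x)) (fun x => (div_le_one hb0).2 (gb x))
    (fun t ht => by
      have : t * a < a := by nlinarith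
      obtain ⟨x, hx⟩ := exists_lt_of_lt_ciSup this
      exact ⟨x, (lt_div_iff₀ ha0).2 hx⟩)
    (fun t ht => by
      have : t * b < b := by nlinarith
      obtain ⟨x, hx⟩ := exists_lt_of_lt_ciSup this
      exact ⟨x, (lt_div_iff₀ hb0).2 hx⟩)
    (fun x y => by
      rw [div_mul_div_comm, div_pow, Real.sq_sqrt hab.le]
      exact div_le_div_of_nonneg_right (H x y) hab.le)
  have key2 := ennreal_amgm _ _ _ key
  have sc : ∀ (u : ℝ → ℝ) (c : ℝ), Measurable u → 0 < c →
      ∫⁻ x, ENNReal.ofReal (u x) = ENNReal.ofReal c * ∫⁻ x, ENNReal.ofReal (u x / c) := by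
    intro u c hu hc
    rw [← lintegral_const_mul _ (by fun_prop)]
    refine lintegral_congr fun x => ?_
    rw [← ENNReal.ofReal_mul hc.le]
    congr 1; field_simp
  rw [sc f a hf ha0, sc g b hg hb0, sc h _ hh (Real.sqrt_pos.2 hab), mul_pow,
    ← ENNReal.ofReal_pow (Real.sqrt_nonneg _), Real.sq_sqrt hab.le, mul_mul_mul_comm,
    ← ENNReal.ofReal_mul ha0.le]
  exact mul_le_mul_right key2 _

lemma pl1 (f g h : ℝ → ℝ≥0∞) (hf : Measurable f) (hg : Measurable g) (hh : Measurable h)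
    (H : ∀ x y, f x * g y ≤ h ((x + y) / 2) ^ 2) :
    (∫⁻ x, f x) * (∫⁻ x, g x) ≤ (∫⁻ x, h x) ^ 2 := by
  have lim : ∀ u : ℝ → ℝ≥0∞, Measurable u →
      ∫⁻ x, u x = ⨆ N : ℕ, ∫⁻ x, min (u x) N := by
    intro u hu
    rw [← lintegral_iSup (fun N => hu.min measurable_const)
      (fun i j hij x => min_le_min_left _ (by exact_mod_cast hij))]
    refine lintegral_congr fun x => ?_
    rw [← inf_iSup_eq, ENNReal.iSup_natCast]; simp
  have b : ∀ N : ℕ, (∫⁻ x, min (f x) N) * (∫⁻ x, min (g x) N) ≤ (∫⁻ x, h x) ^ 2 := by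
    intro N
    have ne : ∀ (u : ℝ → ℝ≥0∞) x, min (u x) N ≠ ∞ := fun u x =>
      ne_top_of_le_ne_top (ENNReal.natCast_ne_top N) (min_le_right _ _)
    have := pl1_bdd (fun x => (min (f x) N).toReal) (fun x => (min (g x) N).toReal)
      (fun x => (min (h x) N).toReal) (hf.min measurable_const).ennreal_toReal
      (hg.min measurable_const).ennreal_toReal
      (hh.min measurable_const).ennreal_toReal (fun x => ENNReal.toReal_nonneg)
      (fun x => ENNReal.toReal_nonneg) (fun x => ENNReal.toReal_nonneg) N
      (fun x => ENNReal.toReal_le_of_le_ofReal (by positivity) (by simp))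
      (fun x => ENNReal.toReal_le_of_le_ofReal (by positivity) (by simp))
      (fun x y => by
        rw [← ENNReal.toReal_mul, ← ENNReal.toReal_pow]
        refine ENNReal.toReal_mono (ENNReal.pow_ne_top (ne _ _)) ?_
        rcases le_total (h ((x + y) / 2)) N with hc | hc
        · rw [min_eq_left hc]
          exact (mul_le_mul' (min_le_left _ _) (min_le_left _ _)).trans (H x y)
        · rw [min_eq_right hc, sq]
          exact mul_le_mul' (min_le_right _ _) (min_le_right _ _))
    simp only [ENNReal.ofReal_toReal (ne _ _)] at this
    exact this.trans (pow_le_pow_left' (lintegral_mono fun x => min_le_left _ _) 2)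
  rw [lim f hf, lim g hg]
  simp only [ENNReal.iSup_mul, ENNReal.mul_iSup]
  refine iSup_le fun j => iSup_le fun i => ?_
  refine le_trans (mul_le_mul' ?_ ?_) (b (max i j))
  · exact lintegral_mono fun x => min_le_min_left _ (by exact_mod_cast le_max_left i j)
  · exact lintegral_mono fun x => min_le_min_left _ (by exact_mod_cast le_max_right i j)

lemma pln (n : ℕ) : ∀ (f g h : (Fin n → ℝ) → ℝ≥0∞), Measurable f → Measurable g → Measurable h →
    (∀ x y, f x * g y ≤ h (fun i => (x i + y i) / 2) ^ 2) →
    (∫⁻ x, f x) * (∫⁻ x, g x) ≤ (∫⁻ x, h x) ^ 2 := by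
  induction n with
  | zero =>
    intro f g h hf hg hh H
    rw [Measure.volume_pi_eq_dirac 0]
    rw [lintegral_dirac, lintegral_dirac, lintegral_dirac]
    have := H 0 0
    convert this using 3
  | succ n ih =>
    intro f g h hf hg hh H
    have fub : ∀ u : (Fin (n + 1) → ℝ) → ℝ≥0∞, Measurable u →
        (Measurable fun s : ℝ => ∫⁻ v : Fin n → ℝ, u (Fin.cons s v)) ∧
        ∫⁻ x, u x = ∫⁻ s : ℝ, ∫⁻ v : Fin n → ℝ, u (Fin.cons s v) := by
      intro u hu
      have mp := (volume_preserving_piFinSuccAbove (fun _ : Fin (n + 1) => ℝ) 0).symm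
      have e : ∀ z : ℝ × (Fin n → ℝ),
          (MeasurableEquiv.piFinSuccAbove (fun _ : Fin (n + 1) => ℝ) 0).symm z =
            Fin.cons z.1 z.2 := by
        intro z
        simp [MeasurableEquiv.piFinSuccAbove_symm_apply, Fin.insertNthEquiv]
      have m : Measurable fun z : ℝ × (Fin n → ℝ) => u (Fin.cons z.1 z.2) := by
        simp_rw [← e]
        exact hu.comp (MeasurableEquiv.measurable _)
      refine ⟨m.lintegral_prod_right', ?_⟩
      rw [← mp.lintegral_comp hu]
      simp_rw [e]
      rw [Measure.volume_eq_prod, lintegral_prod _ m.aemeasurable]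
    rw [(fub f hf).2, (fub g hg).2, (fub h hh).2]
    refine pl1 _ _ _ (fub f hf).1 (fub g hg).1 (fub h hh).1 ?_
    intro s t
    have mc : ∀ s : ℝ, Measurable fun v : Fin n → ℝ => (Fin.cons s v : Fin (n + 1) → ℝ) := by
      intro s
      refine measurable_pi_iff.2 fun i => ?_
      refine Fin.cases ?_ (fun j => ?_) i
      · simp
      · simp; fun_prop
    refine ih _ _ _ (hf.comp (mc s)) (hg.comp (mc t)) (hh.comp (mc _)) ?_
    intro x y
    refine (H _ _).trans (le_of_eq ?_)
    congr 2
    ext i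
    refine Fin.cases ?_ (fun j => ?_) i <;> simp

/-- Midpoint Brunn-Minkowski inequality, multiplicative form. -/
lemma bm {n : ℕ} (A B C : Set (E n)) (hA : MeasurableSet A) (hB : MeasurableSet B)
    (hC : MeasurableSet C) (H : ∀ a ∈ A, ∀ b ∈ B, (2⁻¹ : ℝ) • (a + b) ∈ C) :
    volume A * volume B ≤ volume C ^ 2 := by
  have mp := PiLp.volume_preserving_toLp (Fin n)
  rw [← mp.measure_preimage hA.nullMeasurableSet, ← mp.measure_preimage hB.nullMeasurableSet,
    ← mp.measure_preimage hC.nullMeasurableSet]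
  have mA := mp.measurable hA
  have mB := mp.measurable hB
  have mC := mp.measurable hC
  rw [← lintegral_indicator_one mA, ← lintegral_indicator_one mB, ← lintegral_indicator_one mC]
  refine pln n _ _ _ (measurable_one.indicator mA) (measurable_one.indicator mB)
    (measurable_one.indicator mC) ?_
  intro x y
  by_cases hx : WithLp.toLp 2 x ∈ A
  · by_cases hy : WithLp.toLp 2 y ∈ B
    · have h1 := H _ hx _ hy
      have : (2⁻¹ : ℝ) • (WithLp.toLp 2 x + WithLp.toLp 2 y) =
        (WithLp.toLp 2 (fun i => (x i + y i) / 2) : E n) := by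
        ext i; simp; ring
      rw [this] at h1
      simp [Set.indicator, hx, hy, h1]
    · simp [Set.indicator, hy]
  · simp [Set.indicator, hx]

section dual
variable {n : ℕ} {A : Set (E n)}

lemma dual_bdd (hA : IsCompact A) (y : E n) : BddAbove ((fun x : E n => ⟪x, y⟫) '' A) :=
  (hA.image (by fun_prop)).bddAbove

lemma le_dual (hA : IsCompact A) {x : E n} (hx : x ∈ A) (y : E n) : ⟪x, y⟫ ≤ dualGauge A y :=
  le_csSup (dual_bdd hA y) ⟨x, hx, rfl⟩

lemma dual_le (h0 : A.Nonempty) {y : E n} {c : ℝ} (h : ∀ x ∈ A, ⟪x, y⟫ ≤ c) :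
    dualGauge A y ≤ c := by
  refine csSup_le (h0.image _) ?_
  rintro _ ⟨x, hx, rfl⟩
  exact h x hx

lemma dual_nonneg (hA : IsCompact A) (h0 : (0 : E n) ∈ A) (y : E n) : 0 ≤ dualGauge A y := by
  simpa using le_dual hA h0 y

lemma dual_add (hA : IsCompact A) (h0 : A.Nonempty) (x y : E n) :
    dualGauge A (x + y) ≤ dualGauge A x + dualGauge A y := by
  refine dual_le h0 fun z hz => ?_
  rw [inner_add_right]
  exact add_le_add (le_dual hA hz _) (le_dual hA hz _)

lemma dual_smul (hA : IsCompact A) (h0 : A.Nonempty) {c : ℝ} (hc : 0 ≤ c) (x : E n) :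
    dualGauge A (c • x) = c * dualGauge A x := by
  have key : ∀ c : ℝ, 0 ≤ c → ∀ x, dualGauge A (c • x) ≤ c * dualGauge A x := by
    intro c hc x
    refine dual_le h0 fun z hz => ?_
    rw [inner_smul_right]
    exact mul_le_mul_of_nonneg_left (le_dual hA hz _) hc
  refine le_antisymm (key c hc x) ?_
  rcases hc.eq_or_lt with rfl | hc
  · simp only [zero_smul, zero_mul]
    obtain ⟨z, hz⟩ := h0
    simpa using le_dual hA hz 0
  have := key c⁻¹ (by positivity) (c • x)
  rw [smul_smul, inv_mul_cancel₀ hc.ne', one_smul] at this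
  rwa [le_inv_mul_iff₀ hc] at this

lemma dual_neg (hs : A = -A) (x : E n) : dualGauge A (-x) = dualGauge A x := by
  unfold dualGauge
  congr 1
  ext z
  constructor
  · rintro ⟨a, ha, rfl⟩
    rw [hs] at ha
    exact ⟨-a, ha, by simp⟩
  · rintro ⟨a, ha, rfl⟩
    rw [hs] at ha
    exact ⟨-a, ha, by simp⟩

lemma dual_lip (hA : IsCompact A) (h0 : A.Nonempty) :
    ∃ C : NNReal, LipschitzWith C (dualGauge A) := by
  obtain ⟨R, hR⟩ := hA.isBounded.exists_norm_le
  refine ⟨Real.toNNReal R, LipschitzWith.of_le_add_mul' R fun x y => ?_⟩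
  refine dual_le h0 fun z hz => ?_
  have : ⟪z, x⟫ = ⟪z, y⟫ + ⟪z, x - y⟫ := by rw [inner_sub_right]; ring
  rw [this, dist_eq_norm]
  refine add_le_add (le_dual hA hz _) ((real_inner_le_norm _ _).trans ?_)
  exact mul_le_mul_of_nonneg_right (hR z hz) (norm_nonneg _)

end dual

section sphere

lemma lip_normalize (n : ℕ) : LipschitzOnWith 2 (fun x : E n => ‖x‖⁻¹ • x) {x | 1 ≤ ‖x‖} := by
  refine LipschitzOnWith.of_dist_le_mul fun x hx y hy => ?_
  simp only [Set.mem_ofPred_eq] at hx hy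
  have hx0 : 0 < ‖x‖ := by linarith
  have hy0 : 0 < ‖y‖ := by linarith
  rw [dist_eq_norm, dist_eq_norm]
  have e : ‖x‖⁻¹ • x - ‖y‖⁻¹ • y = ‖x‖⁻¹ • (x - y) + (‖x‖⁻¹ - ‖y‖⁻¹) • y := by
    rw [smul_sub, sub_smul]; abel
  rw [e]
  refine (norm_add_le _ _).trans ?_
  rw [norm_smul, norm_smul, norm_inv, norm_norm]
  have h1 : ‖x‖⁻¹ ≤ 1 := inv_le_one_of_one_le₀ hx
  have h2 : ‖‖x‖⁻¹ - ‖y‖⁻¹‖ * ‖y‖ = ‖x‖⁻¹ * |‖y‖ - ‖x‖| := by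
    have : ‖x‖⁻¹ - ‖y‖⁻¹ = ‖x‖⁻¹ * ‖y‖⁻¹ * (‖y‖ - ‖x‖) := by field_simp
    rw [this, Real.norm_eq_abs, abs_mul, abs_mul, abs_of_pos (inv_pos.2 hx0),
      abs_of_pos (inv_pos.2 hy0)]
    field_simp
  have h3 : |‖y‖ - ‖x‖| ≤ ‖x - y‖ := by
    rw [abs_sub_comm]; exact abs_norm_sub_norm_le x y
  rw [h2]
  have := norm_nonneg (x - y)
  have := inv_pos.2 hx0
  have := abs_nonneg (‖y‖ - ‖x‖)
  simp only [NNReal.coe_ofNat]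
  nlinarith

lemma sphere_finite (m : ℕ) : μH[(m : ℝ)] (usphere (m + 1)) < ∞ := by
  let emb : Fin (m + 1) → ℝ → (Fin m → ℝ) → E (m + 1) := fun i s v =>
    WithLp.toLp 2 (i.insertNth s v : Fin (m + 1) → ℝ)
  let nor : E (m + 1) → E (m + 1) := fun x => ‖x‖⁻¹ • x
  have cover : usphere (m + 1) ⊆ ⋃ i : Fin (m + 1), 
      ((fun v => nor (emb i 1 v)) '' (Icc (-1) 1) ∪ (fun v => nor (emb i (-1) v)) '' (Icc (-1) 1)) := by
    intro x hx
    have hx1 : ‖x‖ = 1 := by simpa [usphere] using hx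
    obtain ⟨i, hi⟩ := Finite.exists_max (fun i => |x i|)
    have hxi : 0 < |x i| := by
      by_contra hcon
      push Not at hcon
      have : x = 0 := by
        ext j
        have := (hi j).trans hcon
        simpa using this
      rw [this] at hx1; simp at hx1
    have main : ∀ s : ℝ, x i = s * |x i| → ∃ v ∈ Icc (-1 : Fin m → ℝ) 1, nor (emb i s v) = x := by
      intro s hs
      refine ⟨fun j => |x i|⁻¹ * x (i.succAbove j), ?_, ?_⟩
      · have : ∀ j, |(|x i|⁻¹ * x (i.succAbove j))| ≤ 1 := by
          intro j
          rw [abs_mul, abs_inv, abs_abs, inv_mul_le_iff₀ hxi, mul_one]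
          exact hi _
        exact ⟨fun j => (abs_le.1 (this j)).1, fun j => (abs_le.1 (this j)).2⟩
      · have e : emb i s (fun j => |x i|⁻¹ * x (i.succAbove j)) = |x i|⁻¹ • x := by
          ext j
          refine Fin.succAboveCases i ?_ (fun j => ?_) j
          · simp only [emb, Fin.insertNth_apply_same, PiLp.smul_apply, smul_eq_mul]
            rw [eq_inv_mul_iff_mul_eq₀ hxi.ne', mul_comm]; exact hs.symm
          · simp [emb]
        simp only [nor, e]
        rw [norm_smul, hx1, norm_inv, Real.norm_eq_abs, abs_abs, smul_smul]
        simp [hxi.ne']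
    refine Set.mem_iUnion.2 ⟨i, ?_⟩
    rcases le_total 0 (x i) with h | h
    · left
      obtain ⟨v, hv, e⟩ := main 1 (by rw [abs_of_nonneg h, one_mul])
      exact ⟨v, hv, e⟩
    · right
      obtain ⟨v, hv, e⟩ := main (-1) (by rw [abs_of_nonpos h]; ring)
      exact ⟨v, hv, e⟩
  have lip : ∀ i s, |s| = 1 → μH[(m : ℝ)] ((fun v => nor (emb i s v)) '' (Icc (-1) 1)) < ∞ := by
    intro i s hs
    have l1 : LipschitzWith 1 (fun v : Fin m → ℝ => (i.insertNth s v : Fin (m + 1) → ℝ)) := by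
      refine LipschitzWith.of_dist_le_mul fun v w => ?_
      rw [NNReal.coe_one, one_mul, dist_pi_le_iff dist_nonneg]
      intro j
      refine Fin.succAboveCases i ?_ (fun j => ?_) j
      · simp
      · simpa using dist_le_pi_dist v w j
    have l2 := (PiLp.lipschitzWith_toLp 2 (fun _ : Fin (m + 1) => ℝ)).comp l1
    have l3 := (lip_normalize (m + 1)).comp (l2.lipschitzOnWith (s := Icc (-1) 1)) (by
      intro v hv
      simp only [Set.mem_ofPred_eq, Function.comp]
      have := PiLp.norm_apply_le (WithLp.toLp 2 (i.insertNth s v : Fin (m + 1) → ℝ)) i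
      simpa [hs] using this)
    have l4 := l3.hausdorffMeasure_image_le (d := (m : ℝ)) (by positivity)
    refine lt_of_le_of_lt l4 (ENNReal.mul_lt_top ?_ ?_)
    · exact ENNReal.rpow_lt_top_of_nonneg (by positivity) ENNReal.coe_ne_top
    · have := hausdorffMeasure_pi_real (ι := Fin m)
      simp only [Fintype.card_fin] at this
      rw [this]
      exact isCompact_Icc.measure_lt_top
  refine lt_of_le_of_lt (measure_mono cover) ?_
  refine lt_of_le_of_lt (measure_iUnion_le _) ?_
  rw [tsum_fintype]
  refine ENNReal.sum_lt_top.2 fun i _ => ?_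
  refine lt_of_le_of_lt (measure_union_le _ _) (ENNReal.add_lt_top.2 ⟨?_, ?_⟩)
  · exact lip i 1 (by simp)
  · exact lip i (-1) (by simp)

lemma sphere_pos (m : ℕ) : 0 < μH[(m : ℝ)] (usphere (m + 1)) := by
  let pr : E (m + 1) → (Fin m → ℝ) := fun x j => x j.succ
  have l : LipschitzWith 1 pr := by
    refine LipschitzWith.of_dist_le_mul fun v w => ?_
    rw [NNReal.coe_one, one_mul, dist_pi_le_iff dist_nonneg]
    intro j
    rw [dist_eq_norm, dist_eq_norm]
    exact PiLp.norm_apply_le (v - w) j.succ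
  have h := l.hausdorffMeasure_image_le (d := (m : ℝ)) (by positivity) (usphere (m + 1))
  have e := hausdorffMeasure_pi_real (ι := Fin m)
  simp only [Fintype.card_fin] at e
  rw [e] at h
  simp only [ENNReal.coe_one, ENNReal.one_rpow, one_mul] at h
  refine lt_of_lt_of_le ?_ h
  have sub : {v : Fin m → ℝ | ∑ j, v j ^ 2 < 1} ⊆ pr '' usphere (m + 1) := by
    intro v hv
    simp only [Set.mem_ofPred_eq] at hv
    refine ⟨WithLp.toLp 2 (Fin.cons (Real.sqrt (1 - ∑ j, v j ^ 2)) v), ?_, ?_⟩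
    · simp only [usphere, mem_sphere_iff_norm, sub_zero]
      rw [EuclideanSpace.norm_eq]
      simp only [Fin.sum_univ_succ, Fin.cons_zero, Fin.cons_succ, Real.norm_eq_abs, sq_abs]
      rw [Real.sq_sqrt (by linarith)]; simp
    · ext j; simp [pr]
  refine lt_of_lt_of_le ?_ (measure_mono sub)
  refine IsOpen.measure_pos _ ?_ ⟨0, by simp⟩
  exact isOpen_lt (by fun_prop) continuous_const

end sphere

lemma sph_ne (n : ℕ) (hn : 0 < n) :
    μH[(n : ℝ) - 1] (usphere n) ≠ 0 ∧ μH[(n : ℝ) - 1] (usphere n) ≠ ∞ := by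
  obtain ⟨m, rfl⟩ : ∃ m, n = m + 1 := ⟨n - 1, by omega⟩
  have : (((m + 1 : ℕ) : ℝ) - 1) = m := by push_cast; ring
  rw [this]
  exact ⟨(sphere_pos m).ne', (sphere_finite m).ne⟩

lemma sph_meas (n : ℕ) : MeasurableSet (usphere n) := Metric.isClosed_sphere.measurableSet

lemma sph_prob (n : ℕ) (hn : 0 < n) : IsProbabilityMeasure (sphMeasure n) := by
  constructor
  simp only [sphMeasure, Measure.smul_apply, Measure.restrict_apply MeasurableSet.univ,
    Set.univ_inter, smul_eq_mul]
  exact ENNReal.inv_mul_cancel (sph_ne n hn).1 (sph_ne n hn).2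

lemma sph_conc (n : ℕ) : sphMeasure n (usphere n)ᶜ = 0 := by
  simp [sphMeasure, Measure.restrict_apply (sph_meas n).compl]

lemma sph_inv (n : ℕ) (e : E n ≃ₗᵢ[ℝ] E n) : MeasurePreserving e (sphMeasure n) (sphMeasure n) := by
  have h1 : MeasurePreserving e (μH[(n : ℝ) - 1]) (μH[(n : ℝ) - 1]) :=
    e.toIsometryEquiv.measurePreserving_hausdorffMeasure _
  have h2 := h1.restrict_preimage (sph_meas n)
  have : e ⁻¹' (usphere n) = usphere n := by
    ext x; simp [usphere]
  rw [this] at h2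
  exact ⟨h2.measurable, by simp only [sphMeasure, Measure.map_smul, h2.map_eq]⟩

lemma exists_rot {n : ℕ} (x y : E n) (h : ‖x‖ = ‖y‖) : ∃ e : E n ≃ₗᵢ[ℝ] E n, e x = y :=
  ⟨_, Submodule.reflection_sub h⟩

/-- Uniqueness of rotation invariant measures on the sphere, tested on Lipschitz functions. -/
lemma sphere_unique {n : ℕ} (μ ν : Measure (E n)) [IsFiniteMeasure μ] [IsFiniteMeasure ν]
    (hμ : μ (usphere n)ᶜ = 0) (hν : ν (usphere n)ᶜ = 0)
    (iμ : ∀ e : E n ≃ₗᵢ[ℝ] E n, MeasurePreserving e μ μ)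
    (iν : ∀ e : E n ≃ₗᵢ[ℝ] E n, MeasurePreserving e ν ν)
    (h : E n → ℝ) (C : NNReal) (hh : LipschitzWith C h) :
    ν.real univ * ∫ x, h x ∂μ = μ.real univ * ∫ x, h x ∂ν := by
  by_cases hn : ν = 0
  · simp [hn]
  have aμ : ∀ᵐ x ∂μ, ‖x‖ = 1 := by
    have : ∀ᵐ x ∂μ, x ∈ usphere n := hμ
    filter_upwards [this] with x hx
    simpa [usphere] using hx
  have aν : ∀ᵐ x ∂ν, ‖x‖ = 1 := by
    have : ∀ᵐ x ∂ν, x ∈ usphere n := hν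
    filter_upwards [this] with x hx
    simpa [usphere] using hx
  have hb : ∀ x : E n, ‖x‖ = 1 → |h x| ≤ |h 0| + C := by
    intro x hx
    have := hh.dist_le_mul x 0
    rw [dist_zero_right, hx, mul_one, Real.dist_eq] at this
    have h2 := abs_sub_abs_le_abs_sub (h x) (h 0)
    linarith
  have hc : Continuous h := hh.continuous
  suffices H : ∀ r > 0, |ν.real univ * ∫ x, h x ∂μ - μ.real univ * ∫ x, h x ∂ν| ≤
      r * (C * μ.real univ * ν.real univ) by
    have h0 : |ν.real univ * ∫ x, h x ∂μ - μ.real univ * ∫ x, h x ∂ν| ≤ 0 := by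
      set D := C * μ.real univ * ν.real univ with hD
      have hD0 : 0 ≤ D := by positivity
      refine le_of_forall_pos_le_add fun ε hε => ?_
      refine (H (ε / (D + 1)) (by positivity)).trans ?_
      rw [zero_add, div_mul_eq_mul_div, div_le_iff₀ (by positivity)]
      nlinarith
    have := abs_nonpos_iff.1 h0
    linarith
  intro r hr
  let k : E n → E n → ℝ := fun x y => max 0 (r - dist x y)
  have kc : Continuous (fun z : E n × E n => k z.1 z.2) := by fun_prop
  have k0 : ∀ x y, 0 ≤ k x y := fun x y => le_max_left _ _
  have kr : ∀ x y, k x y ≤ r := fun x y => max_le hr.le (by linarith [dist_nonneg (x := x) (y := y)])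
  have ksymm : ∀ x y, k x y = k y x := fun x y => by simp [k, dist_comm]
  have kinv : ∀ (e : E n ≃ₗᵢ[ℝ] E n) x y, k (e x) (e y) = k x y := fun e x y => by
    simp [k]
  obtain ⟨x0, hx0⟩ : ∃ x0 : E n, ‖x0‖ = 1 := by
    have : NeZero ν := ⟨hn⟩
    exact aν.exists
  set cμ := ∫ y, k x0 y ∂μ with hcμ
  set cν := ∫ y, k x0 y ∂ν with hcν
  have ceq : ∀ (ρ : Measure (E n)), (∀ e : E n ≃ₗᵢ[ℝ] E n, MeasurePreserving e ρ ρ) →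
      ∀ x, ‖x‖ = 1 → ∫ y, k x y ∂ρ = ∫ y, k x0 y ∂ρ := by
    intro ρ iρ x hx
    obtain ⟨e, he⟩ := exists_rot x0 x (by rw [hx, hx0])
    rw [← (iρ e).integral_comp e.toHomeomorph.measurableEmbedding]
    refine integral_congr_ae (Filter.Eventually.of_forall fun y => ?_)
    simp only [← he, kinv]
  have cpos : 0 < cν := by
    have kx : Continuous (k x0) := by fun_prop
    rw [hcν, integral_pos_iff_support_of_nonneg (fun y => k0 x0 y)
      ((integrable_const r).mono' kx.aestronglyMeasurable
        (Filter.Eventually.of_forall fun y => by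
          rw [Real.norm_eq_abs, abs_of_nonneg (k0 _ _)]; exact kr _ _))]
    have sup : Function.support (k x0) = Metric.ball x0 r := by
      ext y
      simp only [Function.mem_support, Metric.mem_ball, k]
      rw [dist_comm y x0]
      constructor
      · intro h; by_contra hc; push Not at hc
        exact h (max_eq_left (by linarith))
      · intro h; rw [max_eq_right (by linarith)]; linarith
    rw [sup]
    by_contra hcon
    have hz : ν (Metric.ball x0 r) = 0 := by simpa using hcon
    have : ν (usphere n) = 0 := by
      refine measure_null_of_locally_null _ fun x hx => ?_
      refine ⟨Metric.ball x r, mem_nhdsWithin_of_mem_nhds (Metric.ball_mem_nhds x hr), ?_⟩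
      have hx1 : ‖x‖ = 1 := by simpa [usphere] using hx
      obtain ⟨e, he⟩ := exists_rot x x0 (by rw [hx1, hx0])
      rw [← (iν e).measure_preimage Metric.isOpen_ball.measurableSet.nullMeasurableSet] at hz
      rwa [← he, LinearIsometryEquiv.preimage_ball, LinearIsometryEquiv.symm_apply_apply] at hz
    apply hn
    rw [← Measure.measure_univ_eq_zero, ← Set.union_compl_self (usphere n)]
    exact le_antisymm ((measure_union_le _ _).trans (by rw [this, hν, add_zero])) (zero_le)
  have ap1 : ∀ᵐ z ∂(μ.prod ν), ‖z.1‖ = 1 := by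
    exact Measure.quasiMeasurePreserving_fst.ae aμ
  have ap2 : ∀ᵐ z ∂(μ.prod ν), ‖z.2‖ = 1 := by
    exact Measure.quasiMeasurePreserving_snd.ae aν
  have ik : Integrable (fun z : E n × E n => k z.1 z.2) (μ.prod ν) :=
    (integrable_const r).mono' kc.aestronglyMeasurable
        (Filter.Eventually.of_forall fun y => by
          rw [Real.norm_eq_abs, abs_of_nonneg (k0 _ _)]; exact kr _ _)
  have i1 : Integrable (fun z : E n × E n => h z.1 * k z.1 z.2) (μ.prod ν) := by
    refine (integrable_const ((|h 0| + C) * r)).mono' (by fun_prop) ?_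
    filter_upwards [ap1] with z hz
    rw [norm_mul, Real.norm_eq_abs, Real.norm_eq_abs, abs_of_nonneg (k0 _ _)]
    exact mul_le_mul (hb _ hz) (kr _ _) (k0 _ _) (by positivity)
  have i2 : Integrable (fun z : E n × E n => h z.2 * k z.1 z.2) (μ.prod ν) := by
    refine (integrable_const ((|h 0| + C) * r)).mono' (by fun_prop) ?_
    filter_upwards [ap2] with z hz
    rw [norm_mul, Real.norm_eq_abs, Real.norm_eq_abs, abs_of_nonneg (k0 _ _)]
    exact mul_le_mul (hb _ hz) (kr _ _) (k0 _ _) (by positivity)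
  have e1 : ∫ z, h z.1 * k z.1 z.2 ∂(μ.prod ν) = cν * ∫ x, h x ∂μ := by
    rw [integral_prod _ i1, ← integral_const_mul]
    refine integral_congr_ae ?_
    filter_upwards [aμ] with x hx
    rw [integral_const_mul, ceq ν iν x hx, mul_comm]
  have e2 : ∫ z, h z.2 * k z.1 z.2 ∂(μ.prod ν) = cμ * ∫ x, h x ∂ν := by
    rw [integral_prod_symm _ i2, ← integral_const_mul]
    refine integral_congr_ae ?_
    filter_upwards [aν] with x hx
    rw [integral_const_mul]
    simp_rw [ksymm _ x]
    rw [ceq μ iμ x hx, mul_comm]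
  have e3 : ∫ z, k z.1 z.2 ∂(μ.prod ν) = cν * μ.real univ := by
    rw [integral_prod _ ik]
    have : ∫ x, ∫ y, k x y ∂ν ∂μ = ∫ x, cν ∂μ := by
      refine integral_congr_ae ?_
      filter_upwards [aμ] with x hx
      exact ceq ν iν x hx
    rw [this, integral_const, smul_eq_mul, mul_comm]
  have e4 : ∫ z, k z.1 z.2 ∂(μ.prod ν) = cμ * ν.real univ := by
    rw [integral_prod_symm _ ik]
    have : ∫ y, ∫ x, k x y ∂μ ∂ν = ∫ x, cμ ∂ν := by
      refine integral_congr_ae ?_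
      filter_upwards [aν] with x hx
      simp_rw [ksymm _ x]
      exact ceq μ iμ x hx
    rw [this, integral_const, smul_eq_mul, mul_comm]
  have est : |cν * ∫ x, h x ∂μ - cμ * ∫ x, h x ∂ν| ≤ C * r * (cν * μ.real univ) := by
    rw [← e1, ← e2, ← e3, ← integral_sub i1 i2, ← integral_const_mul]
    refine (abs_integral_le_integral_abs).trans ?_
    refine integral_mono (i1.sub i2).abs (ik.const_mul _) fun z => ?_
    simp only
    rw [← sub_mul, abs_mul, abs_of_nonneg (k0 _ _)]
    by_cases hd : dist z.1 z.2 ≤ r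
    · refine mul_le_mul_of_nonneg_right ?_ (k0 _ _)
      rw [← Real.dist_eq]
      exact (hh.dist_le_mul _ _).trans (mul_le_mul_of_nonneg_left hd C.2)
    · have : k z.1 z.2 = 0 := max_eq_left (by linarith)
      rw [this]; simp
  have hr2 : cν * (ν.real univ * ∫ x, h x ∂μ - μ.real univ * ∫ x, h x ∂ν) =
      ν.real univ * (cν * ∫ x, h x ∂μ - cμ * ∫ x, h x ∂ν) := by
    have := e3.symm.trans e4
    linear_combination (-∫ x, h x ∂ν) * this
  have hr3 : cν * |ν.real univ * ∫ x, h x ∂μ - μ.real univ * ∫ x, h x ∂ν| ≤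
      cν * (r * (C * μ.real univ * ν.real univ)) := by
    rw [← abs_of_pos cpos, ← abs_mul, abs_of_pos cpos, hr2, abs_mul, abs_of_nonneg measureReal_nonneg]
    calc _ ≤ ν.real univ * (C * r * (cν * μ.real univ)) :=
          mul_le_mul_of_nonneg_left est measureReal_nonneg
      _ = _ := by ring
  exact le_of_mul_le_mul_left hr3 cpos

abbrev gam (n : ℕ) : Measure (E n) := ProbabilityTheory.stdGaussian (E n)

lemma gam_coord_sq (u : E n) : ∫ x, ⟪u, x⟫ ^ 2 ∂(gam n) = ‖u‖ ^ 2 := by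
  have h := ProbabilityTheory.variance_dual_stdGaussian (E := E n) (innerSL ℝ u)
  have h1 := ProbabilityTheory.integral_strongDual_stdGaussian (E := E n) (innerSL ℝ u)
  rw [ProbabilityTheory.variance_eq_integral (by fun_prop)] at h
  rw [h1] at h
  simpa using h

lemma gam_memLp : MemLp id 2 (gam n) := ProbabilityTheory.IsGaussian.memLp_two_id

lemma gam_norm_int : Integrable (fun x : E n => ‖x‖) (gam n) := by
  have := (gam_memLp (n := n)).integrable (by norm_num)
  exact this.norm

lemma gam_inner_memLp (u : E n) : MemLp (fun x : E n => ⟪u, x⟫) 2 (gam n) :=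
  ((gam_memLp (n := n)).continuousLinearMap_comp (innerSL ℝ u))

lemma gam_norm_sq : ∫ x, ‖x‖ ^ 2 ∂(gam n) = n := by
  have : ∀ x : E n, ‖x‖ ^ 2 = ∑ i, ⟪EuclideanSpace.single i (1:ℝ), x⟫ ^ 2 := by
    intro x
    rw [EuclideanSpace.norm_sq_eq]
    refine Finset.sum_congr rfl fun i _ => ?_
    have := EuclideanSpace.inner_single_left (𝕜 := ℝ) i (1:ℝ) x
    rw [this]; simp
  simp_rw [this]
  rw [integral_finsetSum _ (fun i _ => (gam_inner_memLp _).integrable_sq)]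
  simp_rw [gam_coord_sq]
  simp

lemma gam_norm_le : ∫ x, ‖x‖ ∂(gam n) ≤ √n := by
  have h := ProbabilityTheory.variance_nonneg (fun x : E n => ‖x‖) (gam n)
  have hm : MemLp (fun x : E n => ‖x‖) 2 (gam n) := (gam_memLp (n := n)).norm
  rw [ProbabilityTheory.variance_eq_sub hm] at h
  have e : ∫ x, ((fun x : E n => ‖x‖) ^ 2) x ∂(gam n) = n := gam_norm_sq
  rw [e] at h
  apply Real.le_sqrt_of_sq_le
  linarith

lemma gam_inner_lb (u : E n) : ‖u‖ / 3 ≤ ∫ x, |⟪u, x⟫| ∂(gam n) := by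
  by_cases hu : u = 0
  · simp [hu]
  have hu' : 0 < ‖u‖ := norm_pos_iff.2 hu
  set w : E n := (‖u‖⁻¹ : ℝ) • u with hw
  have wn : ‖w‖ = 1 := by rw [hw, norm_smul]; simp [hu'.ne']
  have uw : u = ‖u‖ • w := by rw [hw, smul_smul, mul_inv_cancel₀ hu'.ne', one_smul]
  have key : 1 / 3 ≤ ∫ x, |⟪w, x⟫| ∂(gam n) := by
    have hc := ProbabilityTheory.charFun_stdGaussian (E := E n) w
    rw [charFun_apply, wn] at hc
    have hi : Integrable (fun x : E n => Complex.exp (⟪x, w⟫ * Complex.I)) (gam n) := by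
      refine Integrable.of_bound (C := 1) (by fun_prop) (ae_of_all _ fun x => ?_)
      rw [Complex.norm_exp_ofReal_mul_I]
    have hre : ∫ x, Real.cos ⟪x, w⟫ ∂(gam n) = Real.exp (-1/2) := by
      have h2 := congrArg Complex.re hc
      have h3 := integral_re (𝕜 := ℂ) hi
      simp only [RCLike.re_to_complex, Complex.exp_ofReal_mul_I_re] at h3
      rw [h3]
      refine h2.trans ?_
      rw [show (-((1:ℝ):ℂ)^2/2) = ((-1/2 : ℝ) : ℂ) by push_cast; ring, ← Complex.ofReal_exp, Complex.ofReal_re]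
    have hci : Integrable (fun x : E n => Real.cos ⟪x, w⟫) (gam n) :=
      Integrable.of_bound (C := 1) (by fun_prop) (ae_of_all _ fun x => by
        rw [Real.norm_eq_abs]; exact abs_cos_le_one _)
    have hmono : ∫ x, (1 - Real.cos ⟪x, w⟫) ∂(gam n) ≤ ∫ x, |⟪w, x⟫| ∂(gam n) := by
      refine integral_mono ((integrable_const _).sub hci)
        ((gam_inner_memLp w).integrable (by norm_num)).abs fun x => ?_
      simp only
      rw [real_inner_comm]
      set z := ⟪w, x⟫
      have h1 := Real.one_sub_sq_div_two_le_cos (x := z)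
      have h2 := Real.neg_one_le_cos z
      have h3 := sq_abs z
      by_cases h : |z| ≤ 2
      · nlinarith [abs_nonneg z]
      · linarith
    rw [integral_sub (integrable_const _) hci, hre] at hmono
    simp at hmono
    have : Real.exp (-1/2) ≤ 2 / 3 := by
      have := Real.add_one_le_exp (1/2 : ℝ)
      rw [show (-1/2 : ℝ) = -(1/2) by ring, Real.exp_neg, inv_le_comm₀ (by positivity) (by norm_num)]
      linarith
    norm_num at hmono this ⊢; linarith
  have : ∀ x : E n, |⟪u, x⟫| = ‖u‖ * |⟪w, x⟫| := by
    intro x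
    conv_lhs => rw [uw]
    rw [inner_smul_left, abs_mul]
    simp
  simp_rw [this]
  rw [integral_const_mul]
  nlinarith

lemma gam_density : ∃ c : ℝ, 0 < c ∧ gam n =
    (volume : Measure (E n)).withDensity (fun x => ENNReal.ofReal (c * Real.exp (-(1/2) * ‖x‖^2))) := by
  set I0 : ℝ := (π / (1/2)) ^ ((n:ℝ) / 2) with hI0
  have I0p : 0 < I0 := by positivity
  have hI := GaussianFourier.integral_rexp_neg_mul_sq_norm (V := E n) (b := 1/2) (by norm_num)
  simp only [finrank_euclideanSpace, Fintype.card_fin] at hI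
  have hIntg : Integrable (fun x : E n => Real.exp (-(1/2) * ‖x‖^2)) := by
    by_contra h
    rw [integral_undef h] at hI
    linarith
  refine ⟨I0⁻¹, by positivity, ?_⟩
  have : IsFiniteMeasure ((volume : Measure (E n)).withDensity
      (fun x => ENNReal.ofReal (I0⁻¹ * Real.exp (-(1/2) * ‖x‖^2)))) :=
    isFiniteMeasure_withDensity_ofReal (hIntg.const_mul _).2
  apply Measure.ext_of_charFun
  ext t
  rw [ProbabilityTheory.charFun_stdGaussian, charFun_apply]
  rw [integral_withDensity_eq_integral_toReal_smul (by fun_prop) (by simp)]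
  have h1 : ∀ x : E n, (ENNReal.ofReal (I0⁻¹ * Real.exp (-(1/2) * ‖x‖^2))).toReal •
      Complex.exp (⟪x, t⟫ * Complex.I) = ((I0⁻¹ : ℝ) : ℂ) *
      Complex.exp (-(1/2 : ℂ) * ‖x‖ ^ 2 + Complex.I * ⟪t, x⟫) := by
    intro x
    rw [ENNReal.toReal_ofReal (by positivity), real_inner_comm, Complex.exp_add, Complex.real_smul]
    push_cast
    rw [mul_comm Complex.I]
    ring
  simp_rw [h1]
  rw [integral_const_mul]
  have := GaussianFourier.integral_cexp_neg_mul_sq_norm_add_of_euclideanSpace (ι := Fin n)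
    (b := (1/2 : ℂ)) (by norm_num) Complex.I t
  rw [this]
  have e1 : ((π : ℂ) / (1/2)) ^ ((Fintype.card (Fin n) : ℂ) / 2) = ((I0 : ℝ) : ℂ) := by
    rw [hI0, Complex.ofReal_cpow (by positivity)]
    push_cast; simp
  rw [e1, ← mul_assoc, ← Complex.ofReal_mul, inv_mul_cancel₀ I0p.ne']
  simp
  congr 1
  ring

lemma gam_shift (Q : Set (E n)) (hQ : MeasurableSet Q) (hs : Q = -Q) (z : E n) :
    ENNReal.ofReal (Real.exp (-‖z‖^2/2)) * gam n Q ≤ gam n ((fun x => x - z) ⁻¹' Q) := by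
  obtain ⟨c, hc, hg⟩ := gam_density (n := n)
  set ρ : E n → ℝ≥0∞ := fun x => ENNReal.ofReal (c * Real.exp (-(1/2) * ‖x‖^2)) with hρ
  have hρm : Measurable ρ := by fun_prop
  have hm : MeasurableSet ((fun x => x - z) ⁻¹' Q) := hQ.preimage (by fun_prop)
  have A1 : gam n ((fun x => x - z) ⁻¹' Q) = ∫⁻ x in Q, ρ (x + z) := by
    rw [hg, withDensity_apply _ hm]
    have := (measurePreserving_sub_right (volume : Measure (E n)) z).setLIntegral_comp_preimage hQ
      (f := fun x => ρ (x + z)) (by fun_prop)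
    rw [← this]
    simp
  have A2 : ∫⁻ x in Q, ρ (x + z) = ∫⁻ x in Q, ρ (-x + z) := by
    have := (Measure.measurePreserving_neg (volume : Measure (E n))).setLIntegral_comp_preimage hQ
      (f := fun x => ρ (-x + z)) (by fun_prop)
    rw [← this]
    have e : (Neg.neg ⁻¹' Q : Set (E n)) = Q := hs.symm
    rw [e]; simp
  have A3 : 2 * (ENNReal.ofReal (Real.exp (-‖z‖^2/2)) * gam n Q) ≤
      2 * gam n ((fun x => x - z) ⁻¹' Q) := by
    conv_rhs => rw [two_mul, A1]
    conv_rhs => arg 2; rw [A2]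
    rw [← lintegral_add_left (by fun_prop), hg, withDensity_apply _ hQ,
      ← lintegral_const_mul _ hρm, ← lintegral_const_mul _ (by fun_prop)]
    refine lintegral_mono fun x => ?_
    simp only [hρ]
    rw [← ENNReal.ofReal_mul (by positivity), ← ENNReal.ofReal_add (by positivity) (by positivity),
      show ∀ a : ℝ≥0∞, 2 * a = ENNReal.ofReal 2 * a by simp, ← ENNReal.ofReal_mul (by positivity)]
    apply ENNReal.ofReal_le_ofReal
    have n1 : ‖x + z‖^2 = ‖x‖^2 + 2 * ⟪x, z⟫ + ‖z‖^2 := norm_add_sq_real x z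
    have n2 : ‖-x + z‖^2 = ‖x‖^2 - 2 * ⟪x, z⟫ + ‖z‖^2 := by
      rw [norm_add_sq_real, inner_neg_left, norm_neg]; ring
    rw [n1, n2, show -(1/2) * (‖x‖^2 + 2 * ⟪x, z⟫ + ‖z‖^2) = -‖z‖^2/2 + -(1/2) * ‖x‖^2 + -⟪x, z⟫ by ring,
      show -(1/2) * (‖x‖^2 - 2 * ⟪x, z⟫ + ‖z‖^2) = -‖z‖^2/2 + -(1/2) * ‖x‖^2 + ⟪x, z⟫ by ring,
      Real.exp_add _ (-⟪x, z⟫), Real.exp_add _ (⟪x, z⟫), Real.exp_add]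
    have h1 := Real.add_one_le_exp (-⟪x, z⟫)
    have h2 := Real.add_one_le_exp (⟪x, z⟫)
    have h3 : 0 < c * (Real.exp (-‖z‖^2/2) * Real.exp (-(1/2) * ‖x‖^2)) := by positivity
    nlinarith
  exact (ENNReal.mul_le_mul_iff_right (by simp) (by simp)).1 A3

def gW (A : Set (E n)) : ℝ := ∫ x, dualGauge A x ∂(gam n)

lemma dual_gam_int {A : Set (E n)} (hA : IsCompact A) (h0 : A.Nonempty) :
    Integrable (dualGauge A) (gam n) := by
  obtain ⟨C, hC⟩ := dual_lip hA h0
  refine ((gam_norm_int (n := n)).const_mul C).mono' hC.continuous.aestronglyMeasurable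
    (ae_of_all _ fun x => ?_)
  have h := hC.dist_le_mul x 0
  have z : dualGauge A (0 : E n) = 0 := by
    have := dual_smul hA h0 le_rfl (0 : E n)
    simpa using this
  rw [z] at h
  simpa [dist_eq_norm] using h

lemma gW_nonneg {A : Set (E n)} (hA : IsCompact A) (h0 : (0 : E n) ∈ A) : 0 ≤ gW A :=
  integral_nonneg fun x => dual_nonneg hA h0 x

lemma Mstar_nonneg {A : Set (E n)} (hA : IsCompact A) (h0 : (0 : E n) ∈ A) : 0 ≤ Mstar A :=
  integral_nonneg fun x => dual_nonneg hA h0 x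

lemma gW_eq (hn : 0 < n) {A : Set (E n)} (hA : IsCompact A) (h0 : (0 : E n) ∈ A) :
    gW A = (∫ x, ‖x‖ ∂(gam n)) * Mstar A := by
  have := sph_prob n hn
  set N : E n → E n := fun x => ‖x‖⁻¹ • x with hN
  have Nm : Measurable N := by fun_prop
  set m0 : Measure (E n) := (gam n).withDensity (fun x => ENNReal.ofReal ‖x‖) with hm0
  have f0 : IsFiniteMeasure m0 := isFiniteMeasure_withDensity_ofReal gam_norm_int.2
  have i0 : ∀ e : E n ≃ₗᵢ[ℝ] E n, MeasurePreserving e m0 m0 := by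
    intro e
    have em : Measurable e := e.continuous.measurable
    refine ⟨em, ?_⟩
    have g : MeasurePreserving e (gam n) (gam n) := ⟨em, ProbabilityTheory.stdGaussian_map e⟩
    ext s hs
    rw [Measure.map_apply em hs, hm0, withDensity_apply _ (em hs), withDensity_apply _ hs,
      ← g.setLIntegral_comp_preimage hs (by fun_prop)]
    simp
  have h1 := sphere_unique (m0.map N) (sphMeasure n) ?_ (sph_conc n) ?_ (sph_inv n) (dualGauge A)
    (dual_lip hA ⟨0, h0⟩).choose (dual_lip hA ⟨0, h0⟩).choose_spec
  · have hc := (dual_lip hA ⟨0, h0⟩).choose_spec.continuous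
    have e1 : (m0.map N).real univ = ∫ x, ‖x‖ ∂(gam n) := by
      rw [measureReal_def, Measure.map_apply Nm MeasurableSet.univ, preimage_univ, hm0,
        withDensity_apply _ MeasurableSet.univ, Measure.restrict_univ,
        ← ofReal_integral_eq_lintegral_ofReal gam_norm_int (ae_of_all _ fun x => norm_nonneg x),
        ENNReal.toReal_ofReal (integral_nonneg fun x => norm_nonneg x)]
    have e2 : ∫ x, dualGauge A x ∂(m0.map N) = gW A := by
      rw [integral_map Nm.aemeasurable hc.aestronglyMeasurable, hm0,
        integral_withDensity_eq_integral_toReal_smul (by fun_prop) (by simp)]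
      refine integral_congr_ae (ae_of_all _ fun x => ?_)
      simp only [ENNReal.toReal_ofReal (norm_nonneg x), smul_eq_mul, hN]
      by_cases hx : x = 0
      · subst hx
        have := dual_smul hA ⟨0, h0⟩ le_rfl (0 : E n)
        simpa using this.symm
      · rw [dual_smul hA ⟨0, h0⟩ (by positivity), ← mul_assoc, mul_inv_cancel₀ (norm_ne_zero_iff.2 hx), one_mul]
    rw [e1, e2] at h1
    simpa [Mstar] using h1
  · rw [Measure.map_apply Nm (sph_meas n).compl]
    have : N ⁻¹' (usphere n)ᶜ ⊆ {0} := by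
      intro x hx
      by_contra h
      apply hx
      have h' : ‖x‖ ≠ 0 := norm_ne_zero_iff.2 h
      simp [usphere, hN, norm_smul, h']
    refine measure_mono_null this ?_
    rw [hm0, withDensity_apply _ (measurableSet_singleton 0)]
    rw [setLIntegral_congr_fun (g := fun _ => 0) (measurableSet_singleton 0)]
    · simp
    · intro x hx
      simp only [mem_singleton_iff] at hx
      simp [hx]
  · intro e
    have em : Measurable e := e.continuous.measurable
    refine ⟨em, ?_⟩
    rw [Measure.map_map em Nm]
    have : e ∘ N = N ∘ e := by
      funext x
      simp [hN]
    rw [this, ← Measure.map_map Nm em, (i0 e).map_eq]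

lemma gW_le (hn : 0 < n) {A : Set (E n)} (hA : IsCompact A) (h0 : (0 : E n) ∈ A) :
    gW A ≤ √n * Mstar A := by
  rw [gW_eq hn hA h0]
  exact mul_le_mul_of_nonneg_right gam_norm_le (Mstar_nonneg hA h0)

lemma norm_le_gW {A : Set (E n)} (hA : IsCompact A) (hs : A = -A) {y : E n} (hy : y ∈ A) :
    ‖y‖ ≤ 3 * gW A := by
  have h := gam_inner_lb y
  have : ∫ x, |⟪y, x⟫| ∂(gam n) ≤ gW A := by
    refine integral_mono ((gam_inner_memLp y).integrable (by norm_num)).abs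
      (dual_gam_int hA ⟨y, hy⟩) fun x => ?_
    refine abs_le'.2 ⟨le_dual hA hy x, ?_⟩
    have hy' : -y ∈ A := by rw [hs]; simpa using hy
    simpa using le_dual hA hy' x
  linarith

lemma dual_cont {A : Set (E n)} (hA : IsCompact A) (h0 : A.Nonempty) : Continuous (dualGauge A) :=
  (dual_lip hA h0).choose_spec.continuous

lemma sudakov {A : Set (E n)} (hA : IsCompact A) (h0 : (0 : E n) ∈ A) (hs : A = -A)
    (hW : 0 < gW A) (F : Finset (E n)) (z : E n) {r t : ℝ} (ht : 0 < t)
    (hF : ∀ x ∈ F, ‖x - z‖ ≤ r) (hsep : ∀ x ∈ F, ∀ y ∈ F, x ≠ y → t < dualGauge A (x - y)) :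
    (F.card : ℝ) ≤ 2 * Real.exp (8 * gW A ^ 2 * r ^ 2 / t ^ 2) := by
  set W := gW A with hWd
  set s := 4 * W / t with hsd
  have sp : 0 < s := by positivity
  have hc := dual_cont hA ⟨0, h0⟩
  set Q : Set (E n) := {x | dualGauge A x ≤ 2 * W} with hQd
  have Qm : MeasurableSet Q := measurableSet_le hc.measurable measurable_const
  have Qs : Q = -Q := by
    ext x
    simp only [hQd, Set.mem_neg, Set.mem_ofPred_eq, dual_neg hs]
  have Qp : 1 / 2 ≤ (gam n).real Q := by
    have h1 := mul_meas_ge_le_integral_of_nonneg (μ := gam n)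
      (ae_of_all _ fun x => dual_nonneg hA h0 x) (dual_gam_int hA ⟨0, h0⟩) (2 * W)
    have h2 : (gam n).real Qᶜ ≤ (gam n).real {x | 2 * W ≤ dualGauge A x} := by
      refine measureReal_mono ?_
      intro x hx
      simp only [hQd, Set.mem_compl_iff, Set.mem_ofPred_eq, not_le] at hx ⊢
      exact hx.le
    have h3 : (gam n).real Qᶜ = 1 - (gam n).real Q := probReal_compl_eq_one_sub Qm
    change 2 * W * (gam n).real {x | 2 * W ≤ dualGauge A x} ≤ W at h1
    have : (gam n).real {x | 2 * W ≤ dualGauge A x} ≤ 1 / 2 := by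
      by_contra h
      push Not at h
      nlinarith
    linarith
  let P : E n → Set (E n) := fun x => (fun w => w - s • (x - z)) ⁻¹' Q
  have Pm : ∀ x, MeasurableSet (P x) := fun x => Qm.preimage (by fun_prop)
  have disj : (F : Set (E n)).PairwiseDisjoint P := by
    intro x hx y hy hxy
    rw [Function.onFun, Set.disjoint_left]
    intro w h1 h2
    have h1' : dualGauge A (w - s • (x - z)) ≤ 2 * W := h1
    have h2' : dualGauge A (w - s • (y - z)) ≤ 2 * W := h2
    have h3 := dual_add hA ⟨0, h0⟩ (w - s • (y - z)) (-(w - s • (x - z)))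
    rw [dual_neg hs] at h3
    have e : (w - s • (y - z)) + (-(w - s • (x - z))) = s • (x - y) := by
      simp only [smul_sub]; abel
    rw [e, dual_smul hA ⟨0, h0⟩ sp.le] at h3
    have h4 := hsep x hx y hy hxy
    have h5 : s * t = 4 * W := by rw [hsd]; field_simp
    nlinarith
  have lb : ∀ x ∈ F, Real.exp (-(8 * W ^ 2 * r ^ 2 / t ^ 2)) / 2 ≤ (gam n).real (P x) := by
    intro x hx
    have h1 := gam_shift Q Qm Qs (s • (x - z))
    have h2 := ENNReal.toReal_mono (measure_ne_top _ _) h1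
    rw [ENNReal.toReal_mul, ENNReal.toReal_ofReal (by positivity)] at h2
    have h3 : -(8 * W ^ 2 * r ^ 2 / t ^ 2) ≤ -‖s • (x - z)‖ ^ 2 / 2 := by
      have h4 : ‖s • (x - z)‖ ≤ s * r := by
        rw [norm_smul, Real.norm_eq_abs, abs_of_pos sp]
        exact mul_le_mul_of_nonneg_left (hF x hx) sp.le
      have h5 : ‖s • (x - z)‖ ^ 2 ≤ (s * r) ^ 2 := pow_le_pow_left₀ (norm_nonneg _) h4 2
      have h6 : (s * r) ^ 2 = 2 * (8 * W ^ 2 * r ^ 2 / t ^ 2) := by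
        rw [hsd]; field_simp; ring
      linarith
    have h7 := Real.exp_le_exp.2 h3
    have h8 : Real.exp (-‖s • (x - z)‖ ^ 2 / 2) * (gam n).real Q ≤ (gam n).real (P x) := h2
    nlinarith [Real.exp_pos (-‖s • (x - z)‖ ^ 2 / 2)]
  have sum := measureReal_biUnion_finset (μ := gam n) disj (fun x _ => Pm x)
  have le1 : (gam n).real (⋃ b ∈ F, P b) ≤ 1 := measureReal_le_one
  have h9 : (F.card : ℝ) * (Real.exp (-(8 * W ^ 2 * r ^ 2 / t ^ 2)) / 2) ≤ 1 := by
    have := Finset.card_nsmul_le_sum F _ _ lb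
    rw [nsmul_eq_mul] at this
    linarith
  rw [Real.exp_neg] at h9
  have ep := Real.exp_pos (8 * W ^ 2 * r ^ 2 / t ^ 2)
  field_simp at h9
  linarith

lemma norm_sq_le_dual {A : Set (E n)} (hA : IsCompact A) (hs : A = -A) {x y : E n} (hx : x ∈ A)
    (hy : y ∈ A) : ‖x - y‖ ^ 2 ≤ 2 * dualGauge A (x - y) := by
  have h1 := le_dual hA hx (x - y)
  have h2 := le_dual hA hy (-(x - y))
  rw [dual_neg hs] at h2
  have : ‖x - y‖ ^ 2 = ⟪x, x - y⟫ + ⟪y, -(x - y)⟫ := by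
    rw [← real_inner_self_eq_norm_sq, inner_sub_left, inner_neg_right]; ring
  linarith

lemma cover_step {A : Set (E n)} (hA : IsCompact A) (h0 : (0 : E n) ∈ A) (hs : A = -A)
    (hW : 0 < gW A) (z : E n) {r : ℝ} (hr : 0 < r) :
    ∃ F : Finset (E n), (F : Set (E n)) ⊆ A ∧
      (F.card : ℝ) ≤ 2 * Real.exp (512 * gW A ^ 2 / r ^ 2) ∧
      ∀ y ∈ A, ‖y - z‖ ≤ r → ∃ x ∈ F, ‖y - x‖ ≤ r / 2 := by
  classical
  let good : Finset (E n) → Prop := fun F => (∀ x ∈ F, x ∈ A ∧ ‖x - z‖ ≤ r) ∧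
    ∀ x ∈ F, ∀ y ∈ F, x ≠ y → r ^ 2 / 8 < dualGauge A (x - y)
  have bound : ∀ F, good F → (F.card : ℝ) ≤ 2 * Real.exp (512 * gW A ^ 2 / r ^ 2) := by
    intro F hF
    have := sudakov hA h0 hs hW F z (r := r) (t := r ^ 2 / 8) (by positivity)
      (fun x hx => (hF.1 x hx).2) hF.2
    convert this using 3
    field_simp; ring
  let P : ℕ → Prop := fun k => ∃ F, good F ∧ F.card = k
  have ex : ∃ k, P k := ⟨0, ∅, by simp [good], rfl⟩
  have hb : ∀ k, P k → k ≤ ⌊2 * Real.exp (512 * gW A ^ 2 / r ^ 2)⌋₊ := by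
    rintro k ⟨F, hF, rfl⟩
    exact Nat.le_floor (bound F hF)
  obtain ⟨F, hF, hc⟩ := Nat.findGreatest_spec (P := P) (hb _ ex.choose_spec) ex.choose_spec
  refine ⟨F, fun x hx => (hF.1 x hx).1, bound F hF, ?_⟩
  intro y hy hyr
  have claim : ∃ x ∈ F, dualGauge A (y - x) ≤ r ^ 2 / 8 := by
    by_contra hcon
    push Not at hcon
    have hyF : y ∉ F := by
      intro h
      have := hcon y h
      rw [sub_self] at this
      have z : dualGauge A (0 : E n) = 0 := by
        have := dual_smul hA ⟨0, h0⟩ le_rfl (0 : E n)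
        simpa using this
      rw [z] at this
      nlinarith
    have g : good (insert y F) := by
      constructor
      · intro x hx
        rcases Finset.mem_insert.1 hx with rfl | hx
        · exact ⟨hy, hyr⟩
        · exact hF.1 x hx
      · intro a ha b hb hab
        rcases Finset.mem_insert.1 ha with rfl | ha2 <;> rcases Finset.mem_insert.1 hb with rfl | hb2
        · exact absurd rfl hab
        · exact hcon b hb2
        · rw [← dual_neg hs, neg_sub]; exact hcon a ha2
        · exact hF.2 a ha2 b hb2 hab
    have p1 : P (F.card + 1) := ⟨_, g, Finset.card_insert_of_notMem hyF⟩
    have := Nat.le_findGreatest (P := P) (hb _ p1) p1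
    omega
  obtain ⟨x, hx, hxy⟩ := claim
  refine ⟨x, hx, ?_⟩
  have := norm_sq_le_dual hA hs hy (hF.1 x hx).1
  refine abs_le_of_sq_le_sq' ?_ (by positivity) |>.2
  nlinarith

lemma nets {A : Set (E n)} (hA : IsCompact A) (h0 : (0 : E n) ∈ A) (hs : A = -A)
    (hW : 0 < gW A) : ∃ F : ℕ → Finset (E n), F 0 = {0} ∧ ∀ k, ((F k : Set (E n)) ⊆ A ∧
      ((F k).card : ℝ) ≤ Real.exp (58 * 4 ^ k) ∧
      ∀ y ∈ A, ∃ x ∈ F k, ‖y - x‖ ≤ 3 * gW A / 2 ^ k) := by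
  classical
  set W := gW A
  suffices H : ∀ k : ℕ, ∃ F : Finset (E n), (k = 0 → F = {0}) ∧ ((F : Set (E n)) ⊆ A ∧
      (F.card : ℝ) ≤ Real.exp (58 * 4 ^ k) ∧
      ∀ y ∈ A, ∃ x ∈ F, ‖y - x‖ ≤ 3 * W / 2 ^ k) by
    choose F h1 h2 using H
    exact ⟨F, h1 0 rfl, h2⟩
  intro k
  induction k with
  | zero =>
    refine ⟨{0}, fun _ => rfl, by simpa using h0, by simp, fun y hy => ⟨0, by simp, ?_⟩⟩
    simpa using norm_le_gW hA hs hy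
  | succ k ih =>
    obtain ⟨F, -, hFA, hFc, hFn⟩ := ih
    have rp : 0 < 3 * W / 2 ^ k := by positivity
    choose G hGA hGc hGn using fun z => cover_step hA h0 hs hW z rp
    refine ⟨F.biUnion G, by simp, ?_, ?_, ?_⟩
    · intro x hx
      simp only [Finset.coe_biUnion, Set.mem_iUnion] at hx
      obtain ⟨z, -, hx⟩ := hx
      exact hGA z hx
    · have h1 : ((F.biUnion G).card : ℝ) ≤ ∑ z ∈ F, ((G z).card : ℝ) := by
        exact_mod_cast Finset.card_biUnion_le
      have h2 : ∀ z ∈ F, ((G z).card : ℝ) ≤ Real.exp (58 * 4 ^ k) := by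
        intro z _
        refine (hGc z).trans ?_
        have e1 : 512 * gW A ^ 2 / (3 * W / 2 ^ k) ^ 2 = 512 / 9 * 4 ^ k := by
          have : (4:ℝ) ^ k = (2 ^ k) ^ 2 := by rw [← pow_mul, mul_comm, pow_mul]; norm_num
          rw [this]
          change 512 * W ^ 2 / (3 * W / 2 ^ k) ^ 2 = _
          field_simp; ring
        rw [e1]
        have e2 : (2 : ℝ) ≤ Real.exp 1 := by linarith [Real.add_one_le_exp (1:ℝ)]
        have e3 : (1 : ℝ) ≤ 4 ^ k := one_le_pow₀ (by norm_num)
        calc 2 * Real.exp (512 / 9 * 4 ^ k) ≤ Real.exp 1 * Real.exp (512 / 9 * 4 ^ k) := by gcongr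
          _ = Real.exp (1 + 512 / 9 * 4 ^ k) := by rw [Real.exp_add]
          _ ≤ _ := Real.exp_le_exp.2 (by linarith)
      have h3 := Finset.sum_le_card_nsmul F _ _ h2
      rw [nsmul_eq_mul] at h3
      calc _ ≤ _ := h1
        _ ≤ _ := h3
        _ ≤ Real.exp (58 * 4 ^ k) * Real.exp (58 * 4 ^ k) := by gcongr
        _ ≤ Real.exp (58 * 4 ^ (k+1)) := by
          rw [← Real.exp_add, pow_succ]
          apply Real.exp_le_exp.2
          have : (0 : ℝ) < 4 ^ k := by positivity
          linarith
    · intro y hy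
      obtain ⟨z, hz, hyz⟩ := hFn y hy
      obtain ⟨x, hx, hyx⟩ := hGn z y hy hyz
      refine ⟨x, Finset.mem_biUnion.2 ⟨z, hz, hx⟩, hyx.trans (le_of_eq ?_)⟩
      rw [pow_succ]; field_simp

abbrev muK (K : Set (E n)) : Measure (E n) := volume.restrict K

lemma muK_prob {K : Set (E n)} {L : ℝ} (hI : IsIsotropic K L) : IsProbabilityMeasure (muK K) :=
  ⟨by simp [hI.1]⟩

lemma muK_apply {K A : Set (E n)} (hA : MeasurableSet A) : muK K A = volume (A ∩ K) :=
  Measure.restrict_apply hA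

lemma bmK {K : Set (E n)} (hK : IsConvexBody K) (h1 : volume K = 1) {A B C : Set (E n)}
    (hA : MeasurableSet A) (hB : MeasurableSet B) (hC : MeasurableSet C)
    (H : ∀ a ∈ A, a ∈ K → ∀ b ∈ B, b ∈ K → (2⁻¹:ℝ)•(a+b) ∈ C) :
    (muK K).real A * (muK K).real B ≤ (muK K).real C ^ 2 := by
  have Km : MeasurableSet K := hK.1.isClosed.measurableSet
  have : IsProbabilityMeasure (muK K) := ⟨by simp [h1]⟩
  have h := bm (A ∩ K) (B ∩ K) (C ∩ K) (hA.inter Km) (hB.inter Km) (hC.inter Km) ?_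
  · rw [← muK_apply hA, ← muK_apply hB, ← muK_apply hC] at h
    have h2 := ENNReal.toReal_mono (by finiteness) h
    rwa [ENNReal.toReal_mul, ENNReal.toReal_pow] at h2
  · rintro a ⟨ha, ha'⟩ b ⟨hb, hb'⟩
    refine ⟨H a ha ha' b hb hb', ?_⟩
    have := hK.2.1 ha' hb' (by norm_num : (0:ℝ) ≤ 2⁻¹) (by norm_num : (0:ℝ) ≤ 2⁻¹) (by norm_num)
    rwa [smul_add]

lemma cont_int {K : Set (E n)} (hK : IsConvexBody K) {f : E n → ℝ} (hf : Continuous f) :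
    Integrable f (muK K) := hf.continuousOn.integrableOn_compact hK.1

lemma muK_neg {K : Set (E n)} (hK : IsConvexBody K) :
    MeasurePreserving (fun x : E n => -x) (muK K) (muK K) := by
  have h := (Measure.measurePreserving_neg (volume : Measure (E n))).restrict_preimage
    hK.1.isClosed.measurableSet
  have e : (Neg.neg ⁻¹' K : Set (E n)) = K := hK.2.2.2.symm
  rw [e] at h
  exact h

lemma tail_unit {K : Set (E n)} {L : ℝ} (hK : IsConvexBody K) (hI : IsIsotropic K L) (hL : 0 < L)
    (u : E n) (hu : ‖u‖ = 1) {σ : ℝ} (hσ : 1 ≤ σ) :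
    (muK K).real {x | 6 * L * σ ≤ |⟪x, u⟫|} ≤ Real.exp (-σ) := by
  have := muK_prob hI
  set φ : ℝ → ℝ := fun s => (muK K).real {x | s ≤ ⟪x, u⟫} with hφ
  have hm : ∀ s : ℝ, MeasurableSet {x : E n | s ≤ ⟪x, u⟫} := fun s =>
    measurableSet_le measurable_const (by fun_prop)
  have sym : ∀ s : ℝ, (muK K).real {x | ⟪x, u⟫ ≤ -s} = φ s := by
    intro s
    have h := (muK_neg hK).measureReal_preimage (hm s).nullMeasurableSet
    rw [hφ]
    simp only
    rw [← h]
    congr 1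
    ext x
    simp [le_neg]
  have two : ∀ s : ℝ, (muK K).real {x | s ≤ |⟪x, u⟫|} ≤ 2 * φ s := by
    intro s
    have h : {x : E n | s ≤ |⟪x, u⟫|} ⊆ {x | s ≤ ⟪x, u⟫} ∪ {x | ⟪x, u⟫ ≤ -s} := by
      intro x hx
      simp only [Set.mem_ofPred_eq, Set.mem_union] at hx ⊢
      rcases le_abs.1 hx with h | h
      · exact Or.inl h
      · exact Or.inr (by linarith)
    have := (measureReal_mono (μ := muK K) h).trans (measureReal_union_le _ _)
    rw [sym] at this
    change _ ≤ φ s + φ s at this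
    linarith
  have half : 1 / 2 ≤ φ 0 := by
    have h := two 0
    have e : {x : E n | 0 ≤ |⟪x, u⟫|} = univ := by ext x; simp
    rw [e, probReal_univ] at h
    linarith
  have anti : ∀ s t, s ≤ t → φ t ≤ φ s := fun s t h =>
    measureReal_mono fun x hx => h.trans hx
  have dbl : ∀ s, 2 * φ (2 * s) ≤ (2 * φ s) ^ 2 := by
    intro s
    have h := bmK hK hI.1 (hm (2*s)) (hm 0) (hm s) (fun a ha _ b hb _ => by
      simp only [Set.mem_ofPred_eq] at ha hb ⊢
      rw [inner_smul_left, inner_add_left]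
      simp only [conj_trivial]
      linarith)
    change φ (2*s) * φ 0 ≤ φ s ^ 2 at h
    have : 0 ≤ φ (2*s) := measureReal_nonneg
    nlinarith
  have base : 2 * φ (3 * L) ≤ Real.exp (-1) := by
    have h1 := mul_meas_ge_le_integral_of_nonneg (μ := muK K) (f := fun x => ⟪x, u⟫ ^ 2)
      (ae_of_all _ fun x => sq_nonneg _) (cont_int hK (by fun_prop)) ((3 * L) ^ 2)
    rw [hI.2 u hu] at h1
    have h2 : φ (3 * L) ≤ (muK K).real {x | (3 * L) ^ 2 ≤ ⟪x, u⟫ ^ 2} := by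
      refine measureReal_mono fun x hx => ?_
      exact pow_le_pow_left₀ (by positivity : 0 ≤ 3 * L) hx 2
    have h3 : φ (3 * L) ≤ 1 / 9 := by
      have : (muK K).real {x | (3 * L) ^ 2 ≤ ⟪x, u⟫ ^ 2} ≤ 1 / 9 := by
        by_contra hc
        push Not at hc
        nlinarith [sq_pos_of_pos hL]
      linarith
    have h4 : Real.exp 1 * Real.exp (-1) = 1 := by rw [← Real.exp_add]; simp
    have h5 := Real.exp_one_lt_d9
    nlinarith [Real.exp_pos (-1)]
  have it : ∀ k : ℕ, 2 * φ (2 ^ k * (3 * L)) ≤ Real.exp (-2 ^ k) := by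
    intro k
    induction k with
    | zero => simpa using base
    | succ k ih =>
      have h := dbl (2 ^ k * (3 * L))
      rw [pow_succ, show (2:ℝ) ^ k * 2 * (3 * L) = 2 * (2 ^ k * (3 * L)) by ring]
      refine h.trans ?_
      have : 0 ≤ φ (2 ^ k * (3 * L)) := measureReal_nonneg
      calc _ ≤ (Real.exp (-2 ^ k)) ^ 2 := by gcongr
        _ = _ := by rw [← Real.exp_nat_mul]; congr 1; push_cast; ring
  obtain ⟨k, hk1, hk2⟩ := exists_nat_pow_near hσ (by norm_num : (1:ℝ) < 2)
  calc _ ≤ 2 * φ (6 * L * σ) := two _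
    _ ≤ 2 * φ (2 ^ (k+1) * (3 * L)) := by
      have := anti (2 ^ (k+1) * (3 * L)) (6 * L * σ) (by rw [pow_succ]; nlinarith)
      linarith
    _ ≤ _ := it _
    _ ≤ _ := Real.exp_le_exp.2 (by linarith)

lemma tail {K : Set (E n)} {L : ℝ} (hK : IsConvexBody K) (hI : IsIsotropic K L) (hL : 0 < L)
    (u : E n) {σ : ℝ} (hσ : 1 ≤ σ) :
    (muK K).real {x | 6 * L * ‖u‖ * σ < |⟪x, u⟫|} ≤ Real.exp (-σ) := by
  have := muK_prob hI
  by_cases hu : u = 0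
  · subst hu; simp; positivity
  have hu' : 0 < ‖u‖ := norm_pos_iff.2 hu
  refine (measureReal_mono ?_).trans (tail_unit hK hI hL (‖u‖⁻¹ • u)
    (by rw [norm_smul]; simp [hu'.ne']) hσ)
  intro x hx
  simp only [Set.mem_ofPred_eq] at hx ⊢
  rw [inner_smul_right, abs_mul, abs_of_pos (by positivity), inv_mul_eq_div, le_div_iff₀ hu']
  linarith

lemma norm_tail {K : Set (E n)} {L : ℝ} (hn : 0 < n) (hK : IsConvexBody K) (hI : IsIsotropic K L) (hL : 0 < L) :
    (muK K).real {x | 4 * √n * L < ‖x‖} ≤ 1 / 16 := by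
  have := muK_prob hI
  have e : ∫ x, ‖x‖ ^ 2 ∂(muK K) = n * L ^ 2 := by
    have : ∀ x : E n, ‖x‖ ^ 2 = ∑ i, ⟪x, EuclideanSpace.single i (1:ℝ)⟫ ^ 2 := by
      intro x
      rw [EuclideanSpace.norm_sq_eq]
      refine Finset.sum_congr rfl fun i _ => ?_
      have := EuclideanSpace.inner_single_right (𝕜 := ℝ) i (1:ℝ) x
      rw [this]; simp
    simp_rw [this]
    rw [integral_finsetSum _ (fun i _ => cont_int hK (by fun_prop))]
    rw [Finset.sum_congr rfl (fun i _ => hI.2 (EuclideanSpace.single i (1:ℝ)) (by simp))]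
    simp
  have h1 := mul_meas_ge_le_integral_of_nonneg (μ := muK K) (f := fun x => ‖x‖ ^ 2)
      (ae_of_all _ fun x => sq_nonneg _) (cont_int hK (by fun_prop)) ((4 * √n * L) ^ 2)
  rw [e, show (4 * √n * L) ^ 2 = 16 * (n * L ^ 2) by
    rw [mul_pow, mul_pow, Real.sq_sqrt (by positivity)]; ring] at h1
  have h2 : (muK K).real {x | 4 * √n * L < ‖x‖} ≤ (muK K).real {x | 16 * (n * L ^ 2) ≤ ‖x‖ ^ 2} := by
    refine measureReal_mono fun x hx => ?_
    simp only [Set.mem_ofPred_eq] at hx ⊢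
    rw [show 16 * (n * L ^ 2) = (4 * √n * L) ^ 2 by
      rw [mul_pow, mul_pow, Real.sq_sqrt (by positivity)]; ring]
    exact pow_le_pow_left₀ (by positivity) hx.le 2
  have np : (0:ℝ) < n := by exact_mod_cast hn
  have p : 0 < n * L ^ 2 := by positivity
  by_contra hc
  push Not at hc
  nlinarith

lemma exp_ten : Real.exp (-10) ≤ 1 / 32 := by
  have h1 : (2:ℝ) ≤ Real.exp 1 := by linarith [Real.add_one_le_exp (1:ℝ)]
  have h2 : (2:ℝ)^5 ≤ Real.exp 10 := by
    calc (2:ℝ)^5 ≤ 2^10 := by norm_num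
      _ ≤ (Real.exp 1)^10 := by gcongr
      _ = Real.exp 10 := by rw [← Real.exp_nat_mul]; norm_num
  rw [Real.exp_neg, inv_le_comm₀ (by positivity) (by norm_num)]
  norm_num at h2 ⊢; exact h2

lemma exp_sum (m : ℕ) : ∑ k ∈ Finset.range m, Real.exp (-(10 * 4 ^ k)) ≤ 1 / 16 := by
  have h : ∀ k : ℕ, Real.exp (-(10 * 4 ^ k)) ≤ (1/32) ^ (k+1) := by
    intro k
    have h1 : ((k:ℝ) + 1) ≤ 4 ^ k := by
      have : k + 1 ≤ 4 ^ k := Nat.lt_pow_self (by norm_num)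
      exact_mod_cast this
    calc Real.exp (-(10 * 4 ^ k)) ≤ Real.exp ((k+1 : ℕ) * (-10)) :=
          Real.exp_le_exp.2 (by push_cast; linarith)
      _ = (Real.exp (-10)) ^ (k+1) := Real.exp_nat_mul _ _
      _ ≤ _ := pow_le_pow_left₀ (by positivity) exp_ten _
  have h2 : ∀ m : ℕ, ∑ k ∈ Finset.range m, ((1:ℝ)/32) ^ (k+1) ≤ 1/16 - 2*(1/32)^(m+1) := by
    intro m
    induction m with
    | zero => norm_num
    | succ m ih =>
      rw [Finset.sum_range_succ, pow_succ _ (m+1)]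
      have : (0:ℝ) < (1/32)^(m+1) := by positivity
      linarith
  have : (0:ℝ) < (1/32)^(m+1) := by positivity
  linarith [h2 m, Finset.sum_le_sum (s := Finset.range m) (fun k _ => h k)]

lemma chain {K A : Set (E n)} {L : ℝ} (hn : 0 < n) (hK : IsConvexBody K) (hI : IsIsotropic K L)
    (hL : 0 < L) (hA : IsCompact A) (h0 : (0 : E n) ∈ A) (hs : A = -A)
    (hW : 0 < gW A) :
    (muK K).real {x | 11000 * (n:ℝ)^((1:ℝ)/4) * L * gW A < dualGauge A x} ≤ 1/8 := by
  have := muK_prob hI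
  obtain ⟨F, F0, hF⟩ := nets hA h0 hs hW
  set W := gW A with hWd
  have n1 : (1:ℝ) ≤ (n:ℝ)^((1:ℝ)/4) := Real.one_le_rpow (by exact_mod_cast hn) (by norm_num)
  obtain ⟨m, hm1, hm2⟩ := exists_nat_pow_near n1 (by norm_num : (1:ℝ) < 2)
  set N := (n:ℝ)^((1:ℝ)/4) with hN
  have NN : √n = N * N := by
    rw [Real.sqrt_eq_rpow, hN, ← Real.rpow_add (by exact_mod_cast hn)]; norm_num
  set c : ℕ → ℝ := fun k => 10800 * L * W * 2 ^ k with hc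
  let S : ℕ → E n × E n → Set (E n) := fun k z =>
    {x | 6 * L * ‖z.2 - z.1‖ * (300 * 4 ^ k) < |⟪x, z.2 - z.1⟫|}
  set B1 : Set (E n) := ⋃ k ∈ Finset.range m, ⋃ z ∈ F k ×ˢ F (k+1), S k z with hB1
  set B2 : Set (E n) := {x | 4 * √n * L < ‖x‖} with hB2
  have m1 : (muK K).real B1 ≤ 1/16 := by
    refine (measureReal_biUnion_finset_le _ _).trans ?_
    refine (Finset.sum_le_sum fun k _ => ?_).trans (exp_sum m)
    refine (measureReal_biUnion_finset_le _ _).trans ?_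
    have h1 : ∀ z ∈ F k ×ˢ F (k+1), (muK K).real (S k z) ≤ Real.exp (-(300 * 4 ^ k)) := by
      intro z _
      refine tail hK hI hL (z.2 - z.1) ?_
      have : (1:ℝ) ≤ 4 ^ k := one_le_pow₀ (by norm_num)
      linarith
    have h2 := Finset.sum_le_card_nsmul _ _ _ h1
    rw [nsmul_eq_mul, Finset.card_product] at h2
    push_cast at h2
    refine h2.trans ?_
    calc _ ≤ Real.exp (58 * 4 ^ k) * Real.exp (58 * 4 ^ (k+1)) * Real.exp (-(300 * 4 ^ k)) := by
          refine mul_le_mul_of_nonneg_right (mul_le_mul (hF k).2.1 (hF (k+1)).2.1 ?_ ?_) ?_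
          · exact Nat.cast_nonneg _
          · exact (Real.exp_pos _).le
          · exact (Real.exp_pos _).le
      _ = _ := by
          rw [← Real.exp_add, ← Real.exp_add]; congr 1; rw [pow_succ]; ring
  have m2 : (muK K).real B2 ≤ 1/16 := norm_tail hn hK hI hL
  have sub : {x | 11000 * N * L * W < dualGauge A x} ⊆ B1 ∪ B2 := by
    intro x hx
    by_contra hcon
    simp only [Set.mem_union, not_or] at hcon
    obtain ⟨c1, c2⟩ := hcon
    simp only [hB2, Set.mem_ofPred_eq, not_lt] at c2
    simp only [hB1, Set.mem_iUnion, not_exists, S, Set.mem_ofPred_eq, not_lt] at c1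
    simp only [Set.mem_ofPred_eq] at hx
    refine absurd hx (not_lt.2 (dual_le ⟨0, h0⟩ fun y hy => ?_))
    choose a ha1 ha2 using fun k => (hF k).2.2 y hy
    have a0 : a 0 = 0 := by
      have := ha1 0
      rw [F0] at this
      simpa using this
    have link : ∀ k ∈ Finset.range m, ⟪x, a (k+1) - a k⟫ ≤ c k := by
      intro k hk
      have h1 := c1 k hk (a k, a (k+1)) (Finset.mem_product.2 ⟨ha1 k, ha1 (k+1)⟩)
      refine (le_abs_self _).trans (h1.trans ?_)
      simp only
      have h2 : ‖a (k+1) - a k‖ ≤ 6 * W / 2 ^ k := by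
        have e : a (k+1) - a k = (y - a k) - (y - a (k+1)) := by abel
        rw [e]
        refine (norm_sub_le _ _).trans ?_
        have := ha2 k
        have h3 := ha2 (k+1)
        have h4 : 3 * W / 2 ^ (k+1) ≤ 3 * W / 2 ^ k := by
          gcongr <;> norm_num
        have h5 : 6 * W / 2 ^ k = 2 * (3 * W / 2 ^ k) := by ring
        linarith
      calc _ ≤ 6 * L * (6 * W / 2 ^ k) * (300 * 4 ^ k) := by gcongr
        _ = c k := by
          have : (4:ℝ) ^ k = 2 ^ k * 2 ^ k := by rw [← mul_pow]; norm_num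
          rw [hc, this]; field_simp; ring
    have tele : ⟪x, a m⟫ = ∑ k ∈ Finset.range m, ⟪x, a (k+1) - a k⟫ := by
      rw [← inner_sum, Finset.sum_range_sub, a0, sub_zero]
    have s1 := Finset.sum_le_sum link
    have s2 : ∀ m : ℕ, ∑ k ∈ Finset.range m, c k ≤ 10800 * L * W * 2 ^ m := by
      intro m
      rw [hc, ← Finset.mul_sum]
      gcongr
      induction m with
      | zero => simp
      | succ m ih => rw [Finset.sum_range_succ, pow_succ]; linarith
    have rem : ⟪x, y - a m⟫ ≤ 24 * N * L * W := by
      refine (real_inner_le_norm _ _).trans ?_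
      calc ‖x‖ * ‖y - a m‖ ≤ (4 * √n * L) * (3 * W / 2 ^ m) := by
            gcongr; exact ha2 m
        _ ≤ _ := by
          rw [NN, show 4 * (N * N) * L * (3 * W / 2 ^ m) = 12 * N * L * W * (N / 2 ^ m) by ring,
            show 24 * N * L * W = 12 * N * L * W * 2 by ring]
          gcongr
          rw [div_le_iff₀ (by positivity)]
          rw [pow_succ] at hm2
          linarith
    have e : ⟪y, x⟫ = ⟪x, y - a m⟫ + ⟪x, a m⟫ := by
      rw [← inner_add_right, sub_add_cancel, real_inner_comm]
    have s3 := s2 m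
    have s4 : 10800 * L * W * 2 ^ m ≤ 10800 * L * W * N := by gcongr
    have s5 : 0 ≤ N * L * W := by positivity
    rw [e, tele]
    nlinarith
  have := (measureReal_mono (μ := muK K) sub).trans (measureReal_union_le _ _)
  linarith

/-- amplification of a constant-probability bound -/
lemma amplify {K A : Set (E n)} (hK : IsConvexBody K) (h1 : volume K = 1)
    (hA : IsCompact A) (h0 : (0 : E n) ∈ A) (hs : A = -A) {s0 : ℝ} (hs0 : 0 < s0)
    (hb : (muK K).real {x | s0 < dualGauge A x} ≤ 1/8) {v : ℝ} (hv : 1 ≤ v) :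
    (muK K).real {x | s0 * v < dualGauge A x} ≤ (2^10 * (Nat.factorial 10 : ℝ)) / v ^ 6 := by
  have : IsProbabilityMeasure (muK K) := ⟨by simp [h1]⟩
  set P : ℝ → ℝ := fun s => (muK K).real {x | s < dualGauge A x} with hP
  have hc := dual_cont hA ⟨0, h0⟩
  have hm : ∀ s : ℝ, MeasurableSet {x : E n | s < dualGauge A x} := fun s =>
    measurableSet_lt measurable_const hc.measurable
  have hm2 : ∀ s : ℝ, MeasurableSet {x : E n | dualGauge A x ≤ s} := fun s =>
    measurableSet_le hc.measurable measurable_const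
  have anti : ∀ s t, s ≤ t → P t ≤ P s := fun s t h =>
    measureReal_mono fun x hx => lt_of_le_of_lt h hx
  have trip : ∀ s, s0 ≤ s → (4/3) * P (3 * s) ≤ ((4/3) * P s) ^ 2 := by
    intro s hss
    have h := bmK hK h1 (hm (3*s)) (hm2 s) (hm s) (fun a ha _ b hb _ => by
      simp only [Set.mem_ofPred_eq] at ha hb ⊢
      rw [dual_smul hA ⟨0, h0⟩ (by norm_num)]
      have h3 := dual_add hA ⟨0, h0⟩ (a + b) (-b)
      rw [dual_neg hs, add_neg_cancel_right] at h3
      linarith)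
    have h4 : (muK K).real {x | dualGauge A x ≤ s} = 1 - P s := by
      rw [hP]; simp only
      rw [← probReal_compl_eq_one_sub (hm s)]
      congr 1
      ext x; simp
    change P (3*s) * _ ≤ P s ^ 2 at h
    rw [h4] at h
    have h5 : P s ≤ 1/8 := (anti _ _ hss).trans hb
    have : 0 ≤ P (3*s) := measureReal_nonneg
    nlinarith
  have it : ∀ k : ℕ, (4/3) * P (3 ^ k * s0) ≤ Real.exp (-2 ^ k) := by
    intro k
    induction k with
    | zero =>
      have h4 : Real.exp 1 * Real.exp (-1) = 1 := by rw [← Real.exp_add]; simp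
      have h5 := Real.exp_one_lt_d9
      have : P s0 ≤ 1/8 := hb
      simp only [pow_zero, one_mul]
      nlinarith [Real.exp_pos (-1)]
    | succ k ih =>
      have h := trip (3 ^ k * s0) (le_mul_of_one_le_left hs0.le (one_le_pow₀ (by norm_num)))
      rw [pow_succ, show (3:ℝ) ^ k * 3 * s0 = 3 * (3 ^ k * s0) by ring]
      refine h.trans ?_
      have : 0 ≤ P (3 ^ k * s0) := measureReal_nonneg
      calc _ ≤ (Real.exp (-2 ^ k)) ^ 2 := by gcongr
        _ = _ := by rw [← Real.exp_nat_mul]; congr 1; push_cast; ring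
  obtain ⟨k, hk1, hk2⟩ := exists_nat_pow_near hv (by norm_num : (1:ℝ) < 3)
  have a1 : P (s0 * v) ≤ P (3 ^ k * s0) := anti _ _ (by nlinarith)
  have a2 := it k
  have a3 : 0 ≤ P (3 ^ k * s0) := measureReal_nonneg
  have a4 := Real.pow_div_factorial_le_exp ((2:ℝ)^k) (by positivity) 10
  have a5 : v ^ 6 ≤ 2 ^ 10 * (2 ^ k) ^ 10 := by
    calc v ^ 6 ≤ (3 ^ (k+1)) ^ 6 := by gcongr
      _ = (729:ℝ) ^ (k+1) := by rw [← pow_mul, mul_comm, pow_mul]; norm_num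
      _ ≤ (1024:ℝ) ^ (k+1) := by gcongr; norm_num
      _ = 2 ^ 10 * (2 ^ k) ^ 10 := by
        rw [← pow_mul, mul_comm k, pow_mul, pow_succ]; norm_num; ring
  have fp : (0:ℝ) < Nat.factorial 10 := by positivity
  change P (s0 * v) ≤ _
  rw [le_div_iff₀ (by positivity)]
  have a6 : (2 ^ k : ℝ) ^ 10 ≤ Nat.factorial 10 * Real.exp (2 ^ k) := by
    rw [div_le_iff₀ fp] at a4; linarith
  have a7 : P (s0 * v) ≤ Real.exp (-2^k) := by linarith
  calc P (s0 * v) * v ^ 6 ≤ Real.exp (-2^k) * (2 ^ 10 * (Nat.factorial 10 * Real.exp (2 ^ k))) := by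
        gcongr; linarith
    _ = 2 ^ 10 * Nat.factorial 10 * (Real.exp (-2^k) * Real.exp (2 ^ k)) := by ring
    _ = _ := by rw [← Real.exp_add]; simp

lemma body_nhds {K : Set (E n)} (hK : IsConvexBody K) : K ∈ nhds (0 : E n) := by
  obtain ⟨hc, hv, ⟨x, hx⟩, hs⟩ := hK
  have hx' : -x ∈ interior K := by
    rw [hs, mem_interior_iff_mem_nhds]
    have := mem_interior_iff_mem_nhds.1 hx
    have h2 := (Homeomorph.neg (E n)).continuous.continuousAt.preimage_mem_nhds
      (x := -x) (t := K) (by simpa using this)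
    exact h2
  have := hv.interior hx hx' (by norm_num : (0:ℝ) ≤ 2⁻¹) (by norm_num : (0:ℝ) ≤ 2⁻¹) (by norm_num)
  rw [smul_neg, add_neg_cancel] at this
  exact mem_interior_iff_mem_nhds.1 this

lemma body_zero {K : Set (E n)} (hK : IsConvexBody K) : (0 : E n) ∈ K := mem_of_mem_nhds (body_nhds hK)

lemma body_gauge {K : Set (E n)} (hK : IsConvexBody K) {x : E n} : gauge K x ≤ 1 ↔ x ∈ K := by
  rw [gauge_le_one_iff_mem_closure hK.2.1 (body_nhds hK), hK.1.isClosed.closure_eq]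

lemma body_absorb {K : Set (E n)} (hK : IsConvexBody K) : Absorbent ℝ K :=
  absorbent_nhds_zero (body_nhds hK)

lemma body_gauge_add {K : Set (E n)} (hK : IsConvexBody K) (x y : E n) :
    gauge K (x + y) ≤ gauge K x + gauge K y := gauge_add_le hK.2.1 (body_absorb hK) x y

lemma body_gauge_neg {K : Set (E n)} (hK : IsConvexBody K) (x : E n) :
    gauge K (-x) = gauge K x := by
  refine gauge_neg (fun x hx => ?_) x
  rw [hK.2.2.2]; simpa using hx

lemma body_gauge_zero {K : Set (E n)} (hK : IsConvexBody K) {x : E n} :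
    gauge K x = 0 ↔ x = 0 :=
  gauge_eq_zero (body_absorb hK) ((NormedSpace.isVonNBounded_iff ℝ).2 hK.1.isBounded)

lemma body_gauge_mem {K : Set (E n)} (hK : IsConvexBody K) {x : E n} {c : ℝ} (hc : 0 ≤ c)
    (h : gauge K x ≤ c) : ∃ k ∈ K, x = c • k := by
  rcases hc.eq_or_lt with rfl | hc'
  · have : gauge K x = 0 := le_antisymm h (gauge_nonneg x)
    exact ⟨0, body_zero hK, by rw [(body_gauge_zero hK).1 this]; simp⟩
  · refine ⟨c⁻¹ • x, (body_gauge hK).1 ?_, by rw [smul_smul, mul_inv_cancel₀ hc'.ne', one_smul]⟩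
    rw [gauge_smul_of_nonneg (by positivity), smul_eq_mul, inv_mul_le_iff₀ hc']
    simpa using h

lemma body_gauge_mid {K : Set (E n)} (x y : E n) :
    gauge K ((2⁻¹:ℝ) • (x + y)) = 2⁻¹ * gauge K (x + y) := by
  rw [gauge_smul_of_nonneg (by norm_num), smul_eq_mul]

lemma mod_le {K : Set (E n)} (hK : IsConvexBody K) {ε : ℝ} {x y : E n} (hx : gauge K x ≤ 1)
    (hy : gauge K y ≤ 1) (h : ε ≤ gauge K (x - y)) :
    modConv K ε ≤ 1 - gauge K ((2⁻¹:ℝ) • (x + y)) := by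
  refine csInf_le ⟨0, ?_⟩ ⟨x, y, hx, hy, h, rfl⟩
  rintro d ⟨x, y, hx, hy, -, rfl⟩
  rw [body_gauge_mid]
  linarith [body_gauge_add hK x y]

lemma conc {K : Set (E n)} {p α : ℝ} (hP : IsPConvexBody K p α) (h1 : volume K = 1)
    {A B : Set (E n)} (hA : MeasurableSet A) (hB : MeasurableSet B) {ε : ℝ} (hε : 0 < ε)
    (H : ∀ a ∈ A, a ∈ K → ∀ b ∈ B, b ∈ K → ε ≤ gauge K (a - b)) :
    (muK K).real A * (muK K).real B ≤ Real.exp (-(2 * n * α * ε ^ p)) := by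
  have hK := hP.1
  have : IsProbabilityMeasure (muK K) := ⟨by simp [h1]⟩
  have Km : MeasurableSet K := hK.1.isClosed.measurableSet
  by_cases hAe : (A ∩ K).Nonempty
  swap
  · rw [Set.not_nonempty_iff_eq_empty] at hAe
    rw [measureReal_def, muK_apply hA, hAe]; simp; positivity
  by_cases hBe : (B ∩ K).Nonempty
  swap
  · rw [Set.not_nonempty_iff_eq_empty] at hBe
    rw [measureReal_def (s := B), muK_apply hB, hBe]; simp; positivity
  have mid : ∀ a ∈ A, a ∈ K → ∀ b ∈ B, b ∈ K → gauge K ((2⁻¹:ℝ) • (a + b)) ≤ 1 - α * ε ^ p := by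
    intro a ha hak b hb hbk
    have hd := H a ha hak b hb hbk
    have ga := (body_gauge hK).2 hak
    have gb := (body_gauge hK).2 hbk
    have e2 : ε ≤ 2 := by
      have := body_gauge_add hK a (-b)
      rw [body_gauge_neg hK, ← sub_eq_add_neg] at this
      linarith
    have := mod_le hK ga gb hd
    linarith [hP.2 ε hε e2]
  set l := 1 - α * ε ^ p with hl
  have l0 : 0 ≤ l := by
    obtain ⟨a, ha, hak⟩ := hAe
    obtain ⟨b, hb, hbk⟩ := hBe
    exact (gauge_nonneg _).trans (mid a ha hak b hb hbk)
  have Cm : MeasurableSet (l • K) := (hK.1.smul l).isClosed.measurableSet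
  have h := bm (A ∩ K) (B ∩ K) (l • K) (hA.inter Km) (hB.inter Km) Cm (by
    rintro a ⟨ha, ha'⟩ b ⟨hb, hb'⟩
    obtain ⟨k, hk, e⟩ := body_gauge_mem hK l0 (mid a ha ha' b hb hb')
    rw [e]; exact Set.smul_mem_smul_set hk)
  have v : volume (l • K) = ENNReal.ofReal (l ^ n) := by
    rw [Measure.addHaar_smul, h1, mul_one]
    simp [abs_of_nonneg l0]
  rw [← muK_apply hA, ← muK_apply hB, v] at h
  have h2 := ENNReal.toReal_mono (by finiteness) h
  rw [ENNReal.toReal_mul, ENNReal.toReal_pow, ENNReal.toReal_ofReal (by positivity)] at h2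
  refine h2.trans ?_
  have h3 : l ≤ Real.exp (-(α * ε ^ p)) := Real.one_sub_le_exp_neg _
  calc (l ^ n) ^ 2 ≤ (Real.exp (-(α * ε ^ p)) ^ n) ^ 2 := by gcongr
    _ = _ := by
      rw [← pow_mul, ← Real.exp_nat_mul]; congr 1; push_cast; ring

lemma weak_median (μ : Measure (E n)) [IsProbabilityMeasure μ] (f : E n → ℝ) (hf : Measurable f)
    {R : ℝ} (hR : ∀ᵐ x ∂μ, |f x| ≤ R) :
    ∃ M, (∀ t > M, 1/2 ≤ μ.real {x | f x ≤ t}) ∧ ∀ t < M, 1/2 ≤ μ.real {x | t < f x} := by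
  set S := {t | 1/2 ≤ μ.real {x | f x ≤ t}} with hS
  have one : ∀ s : Set (E n), (∀ᵐ x ∂μ, x ∈ s) → μ.real s = 1 := by
    intro s hs
    have h2 : s =ᵐ[μ] (univ : Set (E n)) := Filter.eventuallyEq_univ.2 hs
    rw [measureReal_congr h2, probReal_univ]
  have hRS : R ∈ S := by
    simp only [hS, Set.mem_ofPred_eq]
    rw [one]
    · norm_num
    · filter_upwards [hR] with x hx using (abs_le.1 hx).2
  have bd : BddBelow S := by
    refine ⟨-R, fun t ht => ?_⟩
    by_contra hlt
    push Not at hlt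
    simp only [hS, Set.mem_ofPred_eq] at ht
    have : μ.real {x | f x ≤ t} = 0 := by
      rw [measureReal_eq_zero_iff]
      refine measure_mono_null (t := {x | ¬ |f x| ≤ R}) ?_ hR
      intro x hx hx2
      simp only [Set.mem_ofPred_eq] at hx
      linarith [(abs_le.1 hx2).1]
    linarith
  refine ⟨sInf S, fun t ht => ?_, fun t ht => ?_⟩
  · obtain ⟨s, hs, hst⟩ := exists_lt_of_csInf_lt ⟨R, hRS⟩ ht
    exact le_trans hs (measureReal_mono fun x hx => le_trans hx hst.le)
  · have : t ∉ S := fun h => absurd (csInf_le bd h) (not_le.2 ht)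
    simp only [hS, Set.mem_ofPred_eq, not_le] at this
    have h2 : μ.real {x | t < f x} = 1 - μ.real {x | f x ≤ t} := by
      rw [← probReal_compl_eq_one_sub (measurableSet_le hf measurable_const)]
      congr 1
      ext x; simp
    linarith

lemma second_moment (μ : Measure (E n)) [IsProbabilityMeasure μ] (g : E n → ℝ) (hg : Measurable g)
    (g0 : ∀ x, 0 ≤ g x) {R C : ℝ} (hC : 0 ≤ C) (hR : ∀ᵐ x ∂μ, g x ≤ R)
    (ht : ∀ τ ≥ (1:ℝ), μ.real {x | τ ≤ g x} ≤ C / τ ^ 3) : ∫ x, g x ^ 2 ∂μ ≤ 1 + 8 * C := by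
  obtain ⟨N, hN⟩ := pow_unbounded_of_one_lt R (by norm_num : (1:ℝ) < 2)
  let S : ℕ → Set (E n) := fun k => {x | 2 ^ k ≤ g x}
  have Sm : ∀ k, MeasurableSet (S k) := fun k => measurableSet_le measurable_const hg
  have ii : ∀ k, Integrable (fun x => (4:ℝ) ^ (k+1) * (S k).indicator 1 x) μ := fun k =>
    ((integrable_indicator_iff (Sm k)).2 (integrable_const _).integrableOn).const_mul _
  have h1 : ∫ x, g x ^ 2 ∂μ ≤ ∫ x, (1 + ∑ k ∈ Finset.range N, (4:ℝ) ^ (k+1) * (S k).indicator 1 x) ∂μ := by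
    refine integral_mono_of_nonneg (ae_of_all _ fun x => sq_nonneg _)
      ((integrable_const _).add (integrable_finsetSum _ fun k _ => ii k)) ?_
    filter_upwards [hR] with x hx
    have nn : ∀ k ∈ Finset.range N, 0 ≤ (4:ℝ) ^ (k+1) * (S k).indicator 1 x := fun k _ =>
      mul_nonneg (by positivity) (Set.indicator_nonneg (fun _ _ => zero_le_one) _)
    by_cases h : g x < 1
    · have := Finset.sum_nonneg nn
      nlinarith [g0 x]
    · push Not at h
      obtain ⟨k, hk1, hk2⟩ := exists_nat_pow_near h (by norm_num : (1:ℝ) < 2)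
      have hkN : k < N := (pow_lt_pow_iff_right₀ (by norm_num : (1:ℝ) < 2)).1 (by linarith)
      have := Finset.single_le_sum nn (Finset.mem_range.2 hkN)
      have hx : x ∈ S k := hk1
      simp only [Set.indicator_of_mem hx, Pi.one_apply, mul_one] at this
      have h4 : g x ^ 2 ≤ 4 ^ (k+1) := by
        calc g x ^ 2 ≤ (2 ^ (k+1)) ^ 2 := by gcongr
          _ = 4 ^ (k+1) := by rw [← pow_mul, mul_comm, pow_mul]; norm_num
      linarith
  refine h1.trans ?_
  rw [integral_add (integrable_const _) (integrable_finsetSum _ fun k _ => ii k),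
    integral_finsetSum _ fun k _ => ii k]
  have h2 : ∀ k ∈ Finset.range N, ∫ x, (4:ℝ) ^ (k+1) * (S k).indicator 1 x ∂μ ≤ 4 * C * (1/2) ^ k := by
    intro k _
    rw [integral_const_mul, integral_indicator_one (Sm k)]
    have := ht (2 ^ k) (one_le_pow₀ (by norm_num))
    calc (4:ℝ) ^ (k+1) * μ.real (S k) ≤ 4 ^ (k+1) * (C / (2 ^ k) ^ 3) := by gcongr
      _ = 4 * C * (1/2) ^ k := by
        have e4 : (4:ℝ) ^ k = 2 ^ k * 2 ^ k := by rw [← mul_pow]; norm_num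
        rw [pow_succ, e4, one_div, inv_pow]; field_simp
  have h3 := Finset.sum_le_sum h2
  have h4 : ∑ k ∈ Finset.range N, ((1:ℝ)/2) ^ k ≤ 2 := by
    have : ∀ N : ℕ, ∑ k ∈ Finset.range N, ((1:ℝ)/2) ^ k = 2 - 2 * (1/2) ^ N := by
      intro N
      induction N with
      | zero => simp
      | succ N ih => rw [Finset.sum_range_succ, ih, pow_succ]; ring
    rw [this]
    have : (0:ℝ) < (1/2) ^ N := by positivity
    linarith
  rw [← Finset.mul_sum] at h3
  simp
  nlinarith

lemma q_moment (μ : Measure (E n)) [IsProbabilityMeasure μ] (f : E n → ℝ) (hf : Measurable f)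
    {R : ℝ} (hR : ∀ᵐ x ∂μ, |f x| ≤ R) (M : ℝ) {σ q : ℝ} (hσ : 0 < σ) (hq1 : 1 ≤ q) (hq2 : q ≤ 2)
    (h : ∫ x, (f x - M) ^ 2 ∂μ ≤ σ ^ 2) :
    (∫ x, |f x - ∫ y, f y ∂μ| ^ q ∂μ) ^ (1/q) ≤ 2 * σ := by
  have fi : Integrable f μ := Integrable.of_bound (C := R) hf.aestronglyMeasurable
    (by simpa [Real.norm_eq_abs] using hR)
  set m := ∫ y, f y ∂μ with hm
  have bi : ∀ c : ℝ, Integrable (fun x => (f x - c) ^ 2) μ := by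
    intro c
    refine Integrable.of_bound (C := (R + |c|) ^ 2) (by fun_prop) ?_
    filter_upwards [hR] with x hx
    rw [Real.norm_eq_abs, abs_pow]
    exact pow_le_pow_left₀ (abs_nonneg _) ((abs_sub _ _).trans (by linarith)) 2
  have h2 : ∫ x, (f x - m) ^ 2 ∂μ ≤ σ ^ 2 := by
    have e : ∫ x, (f x - M) ^ 2 ∂μ = ∫ x, (f x - m) ^ 2 ∂μ + (m - M) ^ 2 := by
      have e1 : ∀ x, (f x - M) ^ 2 = (f x - m) ^ 2 + (2 * (m - M) * (f x - m) + (m - M) ^ 2) := by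
        intro x; ring
      have i1 : Integrable (fun x => 2 * (m - M) * (f x - m)) μ :=
        (fi.sub (integrable_const _)).const_mul _
      have i2 : Integrable (fun x => 2 * (m - M) * (f x - m) + (m - M) ^ 2) μ :=
        i1.add (integrable_const _)
      simp_rw [e1]
      rw [integral_add (bi m) i2, integral_add i1 (integrable_const _),
        integral_const_mul, integral_sub fi (integrable_const _)]
      simp [← hm]
    nlinarith [sq_nonneg (m - M)]
  have h3 : ∫ x, |f x - m| ^ q ∂μ ≤ 2 * σ ^ q := by
    have : ∫ x, |f x - m| ^ q ∂μ ≤ ∫ x, (σ ^ q + σ ^ q / σ ^ 2 * (f x - m) ^ 2) ∂μ := by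
      refine integral_mono_of_nonneg (ae_of_all _ fun x => by positivity)
        ((integrable_const _).add ((bi m).const_mul _)) (ae_of_all _ fun x => ?_)
      simp only
      set t := |f x - m| / σ with ht
      have t0 : 0 ≤ t := by positivity
      have e1 : |f x - m| = σ * t := by rw [ht]; field_simp
      have e2 : (f x - m) ^ 2 = σ ^ 2 * t ^ 2 := by rw [← sq_abs, e1]; ring
      rw [e2, e1, Real.mul_rpow hσ.le t0]
      have e3 : σ ^ q / σ ^ 2 * (σ ^ 2 * t ^ 2) = σ ^ q * t ^ 2 := by field_simp
      rw [e3]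
      have sp : 0 < σ ^ q := Real.rpow_pos_of_pos hσ q
      have : t ^ q ≤ 1 + t ^ 2 := by
        by_cases h1 : t ≤ 1
        · have := Real.rpow_le_one t0 h1 (by linarith : 0 ≤ q)
          nlinarith
        · push Not at h1
          have := Real.rpow_le_rpow_of_exponent_le h1.le hq2
          rw [Real.rpow_two] at this
          linarith
      nlinarith
    rw [integral_add (integrable_const _) ((bi m).const_mul _), integral_const_mul] at this
    refine this.trans ?_
    have sp : 0 < σ ^ q := Real.rpow_pos_of_pos hσ q
    have : σ ^ q / σ ^ 2 * ∫ x, (f x - m) ^ 2 ∂μ ≤ σ ^ q := by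
      calc _ ≤ σ ^ q / σ ^ 2 * σ ^ 2 := by gcongr
        _ = _ := by field_simp
    simp
    linarith
  have q0 : 0 < q := by linarith
  calc _ ≤ (2 * σ ^ q) ^ (1/q) := by
        refine Real.rpow_le_rpow (integral_nonneg fun x => by positivity) h3 (by positivity)
    _ = 2 ^ (1/q) * σ := by
        rw [Real.mul_rpow (by norm_num) (by positivity), ← Real.rpow_mul hσ.le, mul_one_div_cancel q0.ne',
          Real.rpow_one]
    _ ≤ 2 * σ := by
        gcongr
        have := Real.rpow_le_rpow_of_exponent_le (x := 2) (by norm_num)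
          (by rw [div_le_one q0]; exact hq1 : 1/q ≤ 1)
        simpa using this

lemma conc_tail {K : Set (E n)} {p α : ℝ} (hP : IsPConvexBody K p α) (h1 : volume K = 1)
    {f h : E n → ℝ} (hf : Continuous f) (hh : Continuous h)
    (H : ∀ a b, f b - f a ≤ (h a + h b) * gauge K (b - a)) {M : ℝ}
    (hM1 : ∀ t > M, 1/2 ≤ (muK K).real {x | f x ≤ t})
    (hM2 : ∀ t < M, 1/2 ≤ (muK K).real {x | t < f x}) {s t : ℝ} (hs : 0 < s) (ht : 0 < t)
    (hP8 : (muK K).real {x | s < h x} ≤ 1/8) :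
    (muK K).real {x | t ≤ |f x - M|} ≤
      6 * Real.exp (-(2 * n * α * (t / (4 * s)) ^ p)) + (muK K).real {x | s < h x} := by
  have hK := hP.1
  have : IsProbabilityMeasure (muK K) := ⟨by simp [h1]⟩
  set X := Real.exp (-(2 * n * α * (t / (4 * s)) ^ p)) with hX
  have hms : MeasurableSet {x | h x ≤ s} := measurableSet_le hh.measurable measurable_const
  have loss : ∀ S : Set (E n), 1/2 ≤ (muK K).real S → 3/8 ≤ (muK K).real (S ∩ {x | h x ≤ s}) := by
    intro S hS
    have sub : S ⊆ (S ∩ {x | h x ≤ s}) ∪ {x | s < h x} := by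
      intro x hx
      by_cases hc : h x ≤ s
      · exact Or.inl ⟨hx, hc⟩
      · exact Or.inr (not_le.1 hc)
    have := (measureReal_mono (μ := muK K) sub).trans (measureReal_union_le _ _)
    linarith
  have key : ∀ U V : Set (E n), MeasurableSet U → MeasurableSet V → 1/2 ≤ (muK K).real V →
      (∀ a ∈ U, ∀ b ∈ V, t / 2 ≤ |f a - f b|) →
      (muK K).real (U ∩ {x | h x ≤ s}) ≤ 3 * X := by
    intro U V hU hV hV2 hd
    have h2 := conc hP h1 (hU.inter hms) (hV.inter hms) (ε := t / (4 * s)) (by positivity) (by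
      rintro a ⟨ha, ha2⟩ - b ⟨hb, hb2⟩ -
      have d := hd a ha b hb
      simp only [Set.mem_ofPred_eq] at ha2 hb2
      have g0 : 0 ≤ gauge K (a - b) := gauge_nonneg _
      have e1 := H b a
      have e2 := H a b
      rw [← body_gauge_neg hK, neg_sub] at e2
      rw [div_le_iff₀ (by positivity)]
      rcases le_abs.1 d with d | d <;> nlinarith)
    have h3 := loss V hV2
    have h4 : 0 ≤ (muK K).real (U ∩ {x | h x ≤ s}) := measureReal_nonneg
    rw [← hX] at h2
    nlinarith
  have k1 := key {x | M + t ≤ f x} {x | f x ≤ M + t/2} (measurableSet_le measurable_const hf.measurable)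
    (measurableSet_le hf.measurable measurable_const) (hM1 _ (by linarith)) (by
      intro a ha b hb
      simp only [Set.mem_ofPred_eq] at ha hb
      exact le_abs.2 (Or.inl (by linarith)))
  have k2 := key {x | f x ≤ M - t} {x | M - t/2 < f x} (measurableSet_le hf.measurable measurable_const)
    (measurableSet_lt measurable_const hf.measurable) (hM2 _ (by linarith)) (by
      intro a ha b hb
      simp only [Set.mem_ofPred_eq] at ha hb
      exact le_abs.2 (Or.inr (by linarith)))
  have sub : {x | t ≤ |f x - M|} ⊆ (({x | M + t ≤ f x} ∩ {x | h x ≤ s}) ∪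
      ({x | f x ≤ M - t} ∩ {x | h x ≤ s})) ∪ {x | s < h x} := by
    intro x hx
    simp only [Set.mem_ofPred_eq] at hx
    by_cases hc : h x ≤ s
    · left
      rcases le_abs.1 hx with hx | hx
      · exact Or.inl ⟨by simp only [Set.mem_ofPred_eq]; linarith, hc⟩
      · exact Or.inr ⟨by simp only [Set.mem_ofPred_eq]; linarith, hc⟩
    · exact Or.inr (not_le.1 hc)
  have := (measureReal_mono (μ := muK K) sub).trans (measureReal_union_le _ _)
  have := (measureReal_union_le (μ := muK K) ({x | M + t ≤ f x} ∩ {x | h x ≤ s})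
      ({x | f x ≤ M - t} ∩ {x | h x ≤ s}))
  linarith

def c0 : ℝ := 2^10 * (Nat.factorial 10 : ℝ)
lemma c0_pos : 0 < c0 := by unfold c0; positivity

lemma abstract_bound {K : Set (E n)} {p α : ℝ} (hn : 0 < n) (hα : 0 < α) (hp : 2 ≤ p)
    (hP : IsPConvexBody K p α) (h1 : volume K = 1)
    {f h : E n → ℝ} (hf : Continuous f) (hh : Continuous h)
    (H : ∀ a b, f b - f a ≤ (h a + h b) * gauge K (b - a)) {s0 : ℝ} (hs0 : 0 < s0)
    (hb : (muK K).real {x | s0 < h x} ≤ 1/8)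
    (ht : ∀ v ≥ 1, (muK K).real {x | s0 * v < h x} ≤ c0 / v ^ 6) :
    (∫ x, |f x - ∫ y, f y ∂(muK K)| ^ (p/(p-1)) ∂(muK K)) ^ (1/(p/(p-1))) ≤
      2 * (√(1 + 8 * (6 + c0)) * (4 * s0 / (α * n) ^ (1/p))) := by
  have hK := hP.1
  have c0p := c0_pos
  have : IsProbabilityMeasure (muK K) := ⟨by simp [h1]⟩
  have hKae : ∀ᵐ x ∂(muK K), x ∈ K := ae_restrict_mem hK.1.isClosed.measurableSet
  obtain ⟨R, hR⟩ : ∃ R, ∀ x ∈ K, |f x| ≤ R := by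
    obtain ⟨R, hR⟩ := hK.1.exists_bound_of_continuousOn hf.continuousOn
    exact ⟨R, fun x hx => by simpa using hR x hx⟩
  have hR' : ∀ᵐ x ∂(muK K), |f x| ≤ R := by filter_upwards [hKae] with x hx using hR x hx
  obtain ⟨M, hM1, hM2⟩ := weak_median (muK K) f hf.measurable hR'
  have np : (0:ℝ) < n := by exact_mod_cast hn
  set a := α * n with ha
  have ap : 0 < a := by positivity
  set b := a ^ (1/p) with hbd
  have bp : 0 < b := by positivity
  have bpp : b ^ p = a := by
    rw [hbd, ← Real.rpow_mul ap.le, one_div_mul_cancel (by linarith), Real.rpow_one]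
  set D := 4 * s0 / b with hD
  have Dp : 0 < D := by positivity
  have p1 : 0 < p - 1 := by linarith
  refine q_moment (muK K) f hf.measurable hR' M (by positivity) ?_ ?_ ?_
  · rw [le_div_iff₀ p1]; linarith
  · rw [div_le_iff₀ p1]; linarith
  · have sm := second_moment (muK K) (fun x => |f x - M| / D) (by fun_prop) (fun x => by positivity)
      (R := (R + |M|) / D) (C := 6 + c0) (by positivity) ?_ ?_
    · have e : ∀ x, (|f x - M| / D) ^ 2 = (D ^ 2)⁻¹ * (f x - M) ^ 2 := by
        intro x; rw [div_pow, sq_abs]; field_simp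
      simp_rw [e] at sm
      rw [integral_const_mul, inv_mul_le_iff₀ (by positivity)] at sm
      rw [mul_pow, Real.sq_sqrt (by positivity)]
      linarith
    · filter_upwards [hR'] with x hx
      gcongr
      exact (abs_sub _ _).trans (by linarith)
    · intro τ hτ
      have τ0 : 0 < τ := by linarith
      have e1 : {x | τ ≤ |f x - M| / D} = {x | D * τ ≤ |f x - M|} := by
        ext x; simp only [Set.mem_ofPred_eq]; rw [le_div_iff₀ Dp, mul_comm]
      rw [e1]
      have sq1 : 1 ≤ √τ := Real.one_le_sqrt.2 hτ
      have t1 := ht (√τ) sq1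
      have t2 : (muK K).real {x | s0 * √τ < h x} ≤ 1/8 := by
        refine (measureReal_mono fun x hx => ?_).trans hb
        simp only [Set.mem_ofPred_eq] at hx ⊢
        nlinarith
      have ct := conc_tail hP h1 hf hh H hM1 hM2 (s := s0 * √τ) (t := D * τ) (by positivity) (by positivity) t2
      have e2 : D * τ / (4 * (s0 * √τ)) = √τ / b := by
        have : τ = √τ * √τ := (Real.mul_self_sqrt τ0.le).symm
        rw [hD]
        field_simp
        rw [Real.sq_sqrt τ0.le]
      rw [e2, Real.div_rpow (by positivity) bp.le, bpp] at ct
      have e3 : 2 * n * α * ((√τ) ^ p / a) = 2 * (√τ) ^ p := by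
        rw [ha]; field_simp
      rw [e3] at ct
      have e4 : τ ≤ (√τ) ^ p := by
        have := Real.rpow_le_rpow_of_exponent_le sq1 hp
        rwa [Real.rpow_two, Real.sq_sqrt τ0.le] at this
      have e5 : Real.exp (-(2 * (√τ) ^ p)) ≤ 1 / τ ^ 3 := by
        have f1 : Real.exp (-(2 * (√τ) ^ p)) ≤ Real.exp (-(2 * τ)) := Real.exp_le_exp.2 (by linarith)
        have f2 := Real.pow_div_factorial_le_exp (2 * τ) (by positivity) 3
        have f3 : τ ^ 3 ≤ Real.exp (2 * τ) := by
          have : (2 * τ) ^ 3 / (Nat.factorial 3 : ℝ) = 8 / 6 * τ ^ 3 := by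
            norm_num [Nat.factorial]; ring
          rw [this] at f2
          have : 0 < τ ^ 3 := by positivity
          linarith
        refine f1.trans ?_
        rw [Real.exp_neg, one_div]
        exact inv_anti₀ (by positivity) f3
      have e6 : (√τ) ^ 6 = τ ^ 3 := by
        rw [show 6 = 2 * 3 by norm_num, pow_mul, Real.sq_sqrt τ0.le]
      rw [e6] at t1
      calc _ ≤ _ := ct
        _ ≤ 6 * (1 / τ ^ 3) + c0 / τ ^ 3 := by linarith
        _ = _ := by ring

/-- the case `2 ≤ p` -/
lemma main_p2 {K : Set (E n)} {p α L : ℝ} (hn : 0 < n) (hα : 0 < α) (hL : 0 < L) (hp : 2 ≤ p)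
    (hP : IsPConvexBody K p α) (hI : IsIsotropic K L)
    (T : E n →ₗ[ℝ] E n) (hT : LinearMap.det T = 1) :
    varq (T '' K) (p/(p-1)) (fun x => ‖x‖ ^ 2) ^ ((1 : ℝ) / (p/(p-1))) ≤
      (88000 * √(1 + 8 * (6 + c0))) / (α * n) ^ (1 / p) * (n : ℝ) ^ ((3 : ℝ) / 4) *
                Mstar ((LinearMap.adjoint T ∘ₗ T) '' K) * L := by
  have hK := hP.1
  have := muK_prob hI
  have np : (0:ℝ) < n := by exact_mod_cast hn
  set S := LinearMap.adjoint T ∘ₗ T with hS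
  set A := S '' K with hA
  have Sc : Continuous S := LinearMap.continuous_of_finiteDimensional S
  have Tc : Continuous T := LinearMap.continuous_of_finiteDimensional T
  have Ac : IsCompact A := hK.1.image Sc
  have A0 : (0 : E n) ∈ A := ⟨0, body_zero hK, map_zero S⟩
  have As : A = -A := by
    ext x
    have hs : ∀ y, y ∈ K → -y ∈ K := fun y hy => by rw [hK.2.2.2]; simpa using hy
    constructor
    · rintro ⟨y, hy, rfl⟩
      exact ⟨-y, hs y hy, by simp⟩
    · rintro ⟨y, hy, h⟩
      exact ⟨-y, hs y hy, by rw [map_neg, h, neg_neg]⟩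
  have Tinj : Function.Injective T := by
    have : IsUnit (LinearMap.det T) := by rw [hT]; exact isUnit_one
    exact ((LinearMap.equivOfDetNeZero T (by rw [hT]; norm_num))).injective
  have in1 : ∀ a b, ⟪S a, b⟫ = ⟪T a, T b⟫ := by
    intro a b
    rw [hS, LinearMap.comp_apply, LinearMap.adjoint_inner_left]
  have W0 : 0 < gW A := by
    have : Nontrivial (E n) := by
      have : Nonempty (Fin n) := ⟨⟨0, hn⟩⟩
      infer_instance
    obtain ⟨w, hw⟩ := exists_ne (0 : E n)
    have gw : 0 < gauge K w := lt_of_le_of_ne (gauge_nonneg _) (fun h => hw ((body_gauge_zero hK).1 h.symm))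
    obtain ⟨k, hk, e⟩ := body_gauge_mem hK gw.le le_rfl
    have k0 : k ≠ 0 := by rintro rfl; apply hw; rw [e, smul_zero]
    have Sk : S k ≠ 0 := by
      intro h
      have := in1 k k
      rw [h, inner_zero_left, eq_comm, inner_self_eq_zero] at this
      exact k0 (Tinj (by rw [this, map_zero]))
    have := norm_le_gW Ac As (y := S k) ⟨k, hk, rfl⟩
    have := norm_pos_iff.2 Sk
    linarith
  set s0 := 11000 * (n:ℝ)^((1:ℝ)/4) * L * gW A with hs0
  have s0p : 0 < s0 := by positivity
  have hb := chain hn hK hI hL Ac A0 As W0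
  have dualS : ∀ w z, ⟪S w, z⟫ ≤ gauge K w * dualGauge A z := by
    intro w z
    obtain ⟨k, hk, e⟩ := body_gauge_mem hK (gauge_nonneg w) le_rfl
    have e2 : S w = gauge K w • S k := by rw [← map_smul, ← e]
    rw [e2, inner_smul_left, conj_trivial]
    exact mul_le_mul_of_nonneg_left (le_dual Ac ⟨k, hk, rfl⟩ z) (gauge_nonneg w)
  have ab := abstract_bound hn hα hp hP hI.1 (f := fun x => ‖T x‖ ^ 2) (h := dualGauge A)
    (by fun_prop) (dual_cont Ac ⟨0, A0⟩) (by
      intro a b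
      have e : ‖T b‖ ^ 2 - ‖T a‖ ^ 2 = ⟪S (b - a), a + b⟫ := by
        rw [in1, map_sub, map_add, inner_sub_left, inner_add_right, inner_add_right,
          real_inner_self_eq_norm_sq, real_inner_self_eq_norm_sq, real_inner_comm]; ring
      rw [e]
      refine (dualS _ _).trans ?_
      rw [mul_comm]
      exact mul_le_mul_of_nonneg_right (dual_add Ac ⟨0, A0⟩ _ _) (gauge_nonneg _))
    s0p hb (fun v hv => amplify hK hI.1 Ac A0 As s0p hb hv)
  have cv : ∀ g : E n → ℝ, ∫ x in T '' K, g x = ∫ x, g (T x) ∂(muK K) := by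
    intro g
    have me : MeasurableEmbedding T := Tc.measurableEmbedding Tinj
    have mp : MeasurePreserving T (volume : Measure (E n)) volume := by
      refine ⟨Tc.measurable, ?_⟩
      have := Measure.map_linearMap_addHaar_eq_smul_addHaar (volume : Measure (E n)) (f := T)
        (by rw [hT]; norm_num)
      rw [this, hT]; simp
    exact mp.setIntegral_image_emb me g K
  unfold varq
  rw [cv]
  simp_rw [cv]
  refine ab.trans ?_
  have g1 := gW_le hn Ac A0
  have e34 : (n:ℝ) ^ ((3:ℝ)/4) = (n:ℝ)^((1:ℝ)/4) * √n := by
    rw [Real.sqrt_eq_rpow, ← Real.rpow_add np]; norm_num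
  rw [e34]
  calc 2 * (√(1 + 8 * (6 + c0)) * (4 * s0 / (α * n) ^ (1/p))) =
      (88000 * √(1 + 8 * (6 + c0))) / (α * n) ^ (1 / p) * (n : ℝ) ^ ((1 : ℝ) / 4) * L * gW A := by
        rw [hs0]; ring
    _ ≤ (88000 * √(1 + 8 * (6 + c0))) / (α * n) ^ (1 / p) * (n : ℝ) ^ ((1 : ℝ) / 4) * L *
        (√n * Mstar A) := by
        gcongr
    _ = _ := by ring

lemma exp_compare {β p k : ℝ} (hβ : 0 < β) (h : ∀ t : ℝ, 0 < t → t ≤ 1 → β * t ^ p ≤ t ^ k) : k ≤ p := by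
  by_contra hc
  push Not at hc
  have d : 0 < k - p := by linarith
  set t := min 1 ((β/2) ^ (1/(k-p))) with ht
  have t0 : 0 < t := lt_min one_pos (by positivity)
  have h1 := h t t0 (min_le_left _ _)
  have h2 : t ^ (k-p) ≤ β/2 := by
    calc t ^ (k-p) ≤ ((β/2) ^ (1/(k-p))) ^ (k-p) := by
          gcongr; exact min_le_right _ _
      _ = β/2 := by rw [← Real.rpow_mul (by positivity), one_div_mul_cancel d.ne', Real.rpow_one]
  have h3 : t ^ k = t ^ (k-p) * t ^ p := by rw [← Real.rpow_add t0]; congr 1; ring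
  rw [h3] at h1
  have h4 : 0 < t ^ p := Real.rpow_pos_of_pos t0 p
  nlinarith

lemma p_ge_two {K : Set (E n)} {p α : ℝ} (hn : 2 ≤ n) (hα : 0 < α) (hP : IsPConvexBody K p α) :
    2 ≤ p := by
  have hK := hP.1
  have ne : (Metric.sphere (0 : E n) 1).Nonempty := by
    have : Nonempty (Fin n) := ⟨⟨0, by omega⟩⟩
    exact NormedSpace.sphere_nonempty.2 zero_le_one
  obtain ⟨x, hx, hmax⟩ := (isCompact_sphere (0 : E n) 1).exists_isMaxOn ne
    (continuous_gauge hK.2.1 (body_nhds hK)).continuousOn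
  have xn : ‖x‖ = 1 := by simpa using hx
  set G := gauge K x with hG
  have x0 : x ≠ 0 := by rintro rfl; simp at xn
  have Gp : 0 < G := lt_of_le_of_ne (gauge_nonneg _) fun h => x0 ((body_gauge_zero hK).1 h.symm)
  have ub : ∀ z, gauge K z ≤ G * ‖z‖ := by
    intro z
    by_cases hz : z = 0
    · simp [hz]
    have zp := norm_pos_iff.2 hz
    have h1 : gauge K (‖z‖⁻¹ • z) ≤ G := hmax (by simp [norm_smul, zp.ne'])
    rw [gauge_smul_of_nonneg (by positivity), smul_eq_mul, inv_mul_le_iff₀ zp] at h1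
    linarith
  obtain ⟨y, yn, hxy⟩ : ∃ y : E n, ‖y‖ = 1 ∧ ⟪x, y⟫ = 0 := by
    have hne : (Submodule.span ℝ {x})ᗮ ≠ ⊥ := by
      intro h
      rw [Submodule.orthogonal_eq_bot_iff] at h
      have h2 := finrank_span_singleton (K := ℝ) x0
      rw [h, finrank_top, finrank_euclideanSpace] at h2
      simp at h2; omega
    obtain ⟨w, hw, w0⟩ := Submodule.exists_mem_ne_zero_of_ne_bot hne
    refine ⟨‖w‖⁻¹ • w, by simp [norm_smul, w0], ?_⟩
    rw [inner_smul_right, Submodule.mem_orthogonal_singleton_iff_inner_right.1 hw, mul_zero]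
  have y0 : y ≠ 0 := by rintro rfl; simp at yn
  have gy : 0 < gauge K y := lt_of_le_of_ne (gauge_nonneg _) fun h => y0 ((body_gauge_zero hK).1 h.symm)
  set c := gauge K y / G with hc
  have cp : 0 < c := by positivity
  have c1 : c ≤ 1 := by rw [hc, div_le_one Gp]; simpa [yn] using ub y
  refine exp_compare (β := α * c ^ p) (by positivity) fun t t0 t1 => ?_
  set s := √(1 + t ^ 2) with hs
  have s0 : 0 < s := by positivity
  have ss : s * s = 1 + t ^ 2 := Real.mul_self_sqrt (by positivity)
  have s1 : 1 ≤ s := by nlinarith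
  have s2 : s ≤ 2 := by nlinarith
  have nrm : ∀ r : ℝ, r ^ 2 = t ^ 2 → ‖x + r • y‖ = s := by
    intro r hr
    rw [hs, ← Real.sqrt_sq (norm_nonneg (x + r • y)), norm_add_sq_real, inner_smul_right, hxy, xn,
      norm_smul, yn]
    congr 1
    simp [hr]
  have gu : ∀ r : ℝ, r ^ 2 = t ^ 2 → gauge K ((G * s)⁻¹ • (x + r • y)) ≤ 1 := by
    intro r hr
    rw [gauge_smul_of_nonneg (by positivity), smul_eq_mul, inv_mul_le_iff₀ (by positivity), mul_one]
    simpa [nrm r hr] using ub (x + r • y)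
  have key := mod_le hK (gu t rfl) (gu (-t) (by ring)) (ε := c * t) (by
    rw [← smul_sub, show (x + t • y) - (x + (-t) • y) = (2 * t) • y by module,
      gauge_smul_of_nonneg (by positivity), gauge_smul_of_nonneg (by positivity), smul_eq_mul,
      smul_eq_mul, hc]
    rw [show (G * s)⁻¹ * (2 * t * gauge K y) = gauge K y / G * t * (2 / s) by field_simp]
    have : 1 ≤ 2 / s := by rw [le_div_iff₀ s0]; linarith
    exact le_mul_of_one_le_right (by positivity) this)
  have hm := hP.2 (c * t) (by positivity) (by nlinarith)
  rw [← smul_add, show (x + t • y) + (x + (-t) • y) = (2:ℝ) • x by module,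
    gauge_smul_of_nonneg (by norm_num), gauge_smul_of_nonneg (by positivity),
    gauge_smul_of_nonneg (by norm_num)] at key
  simp only [smul_eq_mul] at key
  rw [← hG, show 2⁻¹ * ((G * s)⁻¹ * (2 * G)) = s⁻¹ by field_simp] at key
  rw [Real.mul_rpow cp.le t0.le] at hm
  have : 1 - s⁻¹ ≤ t ^ 2 := by
    have h2 : 1 - t ^ 2 ≤ s⁻¹ := by
      rw [← one_div, le_div_iff₀ s0]; nlinarith
    linarith
  rw [Real.rpow_two, mul_assoc]
  linarith

lemma n_pos {K : Set (E n)} {p α : ℝ} (hα : 0 < α) (hP : IsPConvexBody K p α) : 0 < n := by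
  rcases Nat.eq_zero_or_pos n with h | h
  swap
  · exact h
  subst h
  exfalso
  have h1 := hP.2 1 one_pos (by norm_num)
  have : modConv K 1 = 0 := by
    unfold modConv
    convert Real.sInf_empty
    ext d
    simp only [Set.mem_ofPred_eq, Set.mem_empty_iff_false, iff_false]
    rintro ⟨x, y, -, -, h, -⟩
    rw [Subsingleton.elim (x - y) 0, gauge_zero] at h
    linarith
  rw [this, Real.one_rpow] at h1
  linarith

lemma exists_gauge_one {K : Set (E n)} (hn : 0 < n) (hK : IsConvexBody K) : ∃ x, gauge K x = 1 := by
  have : Nontrivial (E n) := by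
    have : Nonempty (Fin n) := ⟨⟨0, hn⟩⟩
    infer_instance
  obtain ⟨w, hw⟩ := exists_ne (0 : E n)
  have gw : 0 < gauge K w := lt_of_le_of_ne (gauge_nonneg _) (fun h => hw ((body_gauge_zero hK).1 h.symm))
  refine ⟨(gauge K w)⁻¹ • w, ?_⟩
  rw [gauge_smul_of_nonneg (by positivity), smul_eq_mul, inv_mul_cancel₀ gw.ne']

lemma p_ge_one {K : Set (E n)} {p α : ℝ} (hα : 0 < α) (hP : IsPConvexBody K p α) : 1 ≤ p := by
  have hn := n_pos hα hP
  have hK := hP.1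
  obtain ⟨x, hx⟩ := exists_gauge_one hn hK
  refine exp_compare hα fun t t0 t1 => ?_
  have g : gauge K ((1 - t) • x) = 1 - t := by
    rw [gauge_smul_of_nonneg (by linarith), hx, smul_eq_mul, mul_one]
  have h1 := mod_le hK hx.le (g.le.trans (by linarith)) (ε := t) (by
    rw [show x - (1 - t) • x = t • x by module, gauge_smul_of_nonneg t0.le, hx, smul_eq_mul, mul_one])
  rw [show (2⁻¹:ℝ) • (x + (1 - t) • x) = (1 - t/2) • x by module,
    gauge_smul_of_nonneg (by linarith), hx, smul_eq_mul, mul_one] at h1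
  rw [Real.rpow_one]
  linarith [hP.2 t t0 (by linarith)]

lemma alpha_le {K : Set (E n)} {p α : ℝ} (hα : 0 < α) (hP : IsPConvexBody K p α) : α ≤ 1 := by
  have hn := n_pos hα hP
  have hp := p_ge_one hα hP
  have hK := hP.1
  obtain ⟨x, hx⟩ := exists_gauge_one hn hK
  have h1 := mod_le hK hx.le ((body_gauge_neg hK x).trans hx).le (ε := 2) (by
    rw [show x - -x = (2:ℝ) • x by module, gauge_smul_of_nonneg (by norm_num), hx, smul_eq_mul, mul_one])
  have h2 := hP.2 2 (by norm_num) le_rfl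
  have h3 : (1:ℝ) ≤ 2 ^ p := Real.one_le_rpow (by norm_num) (by linarith)
  have h4 : 0 ≤ gauge K ((2⁻¹:ℝ) • (x + -x)) := gauge_nonneg _
  nlinarith

lemma det_one_id (T : E 1 →ₗ[ℝ] E 1) (hT : LinearMap.det T = 1) : T = LinearMap.id := by
  have fr : Module.finrank ℝ (E 1) = 1 := by simp
  obtain ⟨c, hc⟩ := (LinearEquiv.smul_id_of_finrank_eq_one (R := ℝ) (M := E 1) fr).surjective T
  have hc' : T = c • LinearMap.id := hc.symm
  rw [hc', LinearMap.det_smul, fr] at hT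
  simp at hT
  rw [hc', hT, one_smul]

lemma dim_one_ball {K : Set (E 1)} (hK : IsConvexBody K) {x y : E 1} (hx : x ∈ K) (h : ‖y‖ ≤ ‖x‖) :
    y ∈ K := by
  by_cases x0 : x = 0
  · rw [x0, norm_zero, norm_le_zero_iff] at h
    rw [h]; exact body_zero hK
  have nm : ∀ z : E 1, ‖z‖ = |z 0| := by
    intro z; rw [EuclideanSpace.norm_eq]; simp
    exact Real.sqrt_sq_eq_abs _
  have xp : 0 < |x 0| := by rw [← nm]; exact norm_pos_iff.2 x0
  have x00 : x 0 ≠ 0 := abs_pos.1 xp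
  have e : y = (y 0 / x 0) • x := by
    ext i
    fin_cases i
    simp [x00]
  have c1 : |y 0 / x 0| ≤ 1 := by
    rw [abs_div, div_le_one xp, ← nm, ← nm]; exact h
  rw [e]
  set c := y 0 / x 0
  rcases le_total 0 c with hc | hc
  · exact hK.2.1.smul_mem_of_zero_mem (body_zero hK) hx ⟨hc, (le_abs_self c).trans c1⟩
  · have hx' : -x ∈ K := by rw [hK.2.2.2]; simpa using hx
    have := hK.2.1.smul_mem_of_zero_mem (body_zero hK) hx' (t := -c) ⟨by linarith, (neg_le_abs c).trans c1⟩
    simpa using this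

def v1 : ℝ := (volume (Metric.ball (0 : E 1) 1)).toReal

lemma main_n1 {K : Set (E 1)} {p α L : ℝ} (hα : 0 < α) (hL : 0 < L) (hp1 : 1 ≤ p) (hp : p < 2)
    (hP : IsPConvexBody K p α) (hI : IsIsotropic K L)
    (T : E 1 →ₗ[ℝ] E 1) (hT : LinearMap.det T = 1) :
    varq (T '' K) (p/(p-1)) (fun x => ‖x‖ ^ 2) ^ ((1 : ℝ) / (p/(p-1))) ≤
      (9 * (1 + v1 ^ 2)) / (α * (1:ℕ)) ^ (1 / p) * ((1:ℕ) : ℝ) ^ ((3 : ℝ) / 4) *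
                Mstar ((LinearMap.adjoint T ∘ₗ T) '' K) * L := by
  have hK := hP.1
  have := muK_prob hI
  have hKae : ∀ᵐ x ∂(muK K), x ∈ K := ae_restrict_mem hK.1.isClosed.measurableSet
  have Tid := det_one_id T hT
  subst Tid
  have im : (LinearMap.adjoint (LinearMap.id : E 1 →ₗ[ℝ] E 1) ∘ₗ LinearMap.id) '' K = K := by
    have : LinearMap.adjoint (LinearMap.id : E 1 →ₗ[ℝ] E 1) = LinearMap.id := by
      refine ((LinearMap.eq_adjoint_iff _ _).2 fun x y => rfl).symm
    rw [this]; simp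
  have im2 : (LinearMap.id : E 1 →ₗ[ℝ] E 1) '' K = K := by simp
  rw [im, im2]
  obtain ⟨x, hx, hmax⟩ := hK.1.exists_isMaxOn ⟨0, body_zero hK⟩ (continuous_norm.continuousOn)
  set R := ‖x‖ with hR
  have Rmax : ∀ y ∈ K, ‖y‖ ≤ R := fun y hy => hmax hy
  have R0 : 0 ≤ R := norm_nonneg x
  have Rv : 1 ≤ R * v1 := by
    have h1 : volume K ≤ volume (Metric.closedBall (0 : E 1) R) :=
      measure_mono fun y hy => by simpa using Rmax y hy
    rw [hI.1, Measure.addHaar_closedBall _ _ R0] at h1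
    have h2 := ENNReal.toReal_mono (by
      exact ENNReal.mul_ne_top ENNReal.ofReal_ne_top measure_ball_lt_top.ne) h1
    rw [ENNReal.toReal_mul, ENNReal.toReal_ofReal (by positivity)] at h2
    simpa [v1] using h2
  have MR : R / 3 ≤ Mstar K := by
    have h1 := gW_le (n := 1) one_pos hK.1 (body_zero hK)
    have h2 := norm_le_gW hK.1 hK.2.2.2 hx
    simp at h1
    linarith
  have LR : R / 3 ≤ L := by
    let u : E 1 := EuclideanSpace.single 0 1
    have un : ‖u‖ = 1 := by simp [u]
    have hu := hI.2 u un
    have iu : ∀ z : E 1, ⟪z, u⟫ ^ 2 = ‖z‖ ^ 2 := by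
      intro z
      have h3 := EuclideanSpace.inner_single_right (𝕜 := ℝ) (0 : Fin 1) (1:ℝ) z
      rw [show u = EuclideanSpace.single 0 1 from rfl, h3, EuclideanSpace.norm_eq]; simp
      rw [Real.sq_sqrt (sq_nonneg _)]
    simp_rw [iu] at hu
    have h1 := mul_meas_ge_le_integral_of_nonneg (μ := muK K) (f := fun x => ‖x‖ ^ 2)
      (ae_of_all _ fun x => sq_nonneg _) (cont_int hK (by fun_prop)) ((R/2) ^ 2)
    rw [hu] at h1
    have h2 : 1/2 ≤ (muK K).real {z | (R/2)^2 ≤ ‖z‖^2} := by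
      have hm : MeasurableSet {z : E 1 | (R/2)^2 ≤ ‖z‖^2} := measurableSet_le (by fun_prop) (by fun_prop)
      have h3 : (muK K).real {z | (R/2)^2 ≤ ‖z‖^2}ᶜ ≤ 1/2 := by
        have sub : {z : E 1 | (R/2)^2 ≤ ‖z‖^2}ᶜ ∩ K ⊆ (1/2:ℝ) • K := by
          rintro z ⟨hz, -⟩
          simp only [Set.mem_compl_iff, Set.mem_ofPred_eq, not_le] at hz
          have h4 : ‖z‖ < R/2 := lt_of_pow_lt_pow_left₀ 2 (by positivity) hz
          refine ⟨(2:ℝ) • z, dim_one_ball hK hx ?_, by simp [smul_smul]⟩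
          rw [norm_smul]; norm_num; linarith
        rw [measureReal_def, muK_apply hm.compl]
        have h5 := measure_mono (μ := (volume : Measure (E 1))) sub
        rw [Measure.addHaar_smul, hI.1] at h5
        have h6 := ENNReal.toReal_mono (by finiteness) h5
        refine h6.trans ?_
        simp
      rw [probReal_compl_eq_one_sub hm] at h3
      linarith
    have h3 : (R/2)^2 * (1/2) ≤ L^2 := by
      refine le_trans ?_ h1
      gcongr
    by_contra hc
    push Not at hc
    nlinarith
  have apow : α ^ (1/p) ≤ 1 := Real.rpow_le_one hα.le (alpha_le hα hP) (by positivity)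
  have apos : 0 < α ^ (1/p) := by positivity
  have LHS : varq K (p/(p-1)) (fun x => ‖x‖ ^ 2) ^ ((1 : ℝ) / (p/(p-1))) ≤ (1 + v1 ^ 2) * R ^ 2 := by
    rcases hp1.eq_or_lt with rfl | hp1'
    · simp
      nlinarith [sq_nonneg R]
    · have q0 : 0 < p / (p-1) := div_pos (by linarith) (by linarith)
      set q := p / (p-1)
      have h1 : varq K q (fun x => ‖x‖ ^ 2) ≤ (R ^ 2) ^ q := by
        unfold varq
        have m0 : 0 ≤ ∫ y in K, ‖y‖ ^ 2 := integral_nonneg fun y => by positivity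
        have m1 : ∫ y in K, ‖y‖ ^ 2 ≤ R ^ 2 := by
          have : ∫ y in K, ‖y‖ ^ 2 ≤ ∫ y in K, R ^ 2 := by
            refine integral_mono_of_nonneg (ae_of_all _ fun y => by positivity) (integrable_const _) ?_
            filter_upwards [hKae] with y hy
            exact pow_le_pow_left₀ (norm_nonneg _) (Rmax y hy) 2
          simpa using this
        have : ∫ x in K, |‖x‖ ^ 2 - ∫ y in K, ‖y‖ ^ 2| ^ q ≤ ∫ x in K, (R ^ 2) ^ q := by
          refine integral_mono_of_nonneg (ae_of_all _ fun y => by positivity) (integrable_const _) ?_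
          filter_upwards [hKae] with y hy
          refine Real.rpow_le_rpow (abs_nonneg _) ?_ q0.le
          have h2 := pow_le_pow_left₀ (norm_nonneg _) (Rmax y hy) 2
          have h3 : 0 ≤ ‖y‖ ^ 2 := by positivity
          rw [abs_le]; constructor <;> linarith
        simpa using this
      have h0 : 0 ≤ varq K q (fun x => ‖x‖ ^ 2) := integral_nonneg fun y => by positivity
      have h2 := Real.rpow_le_rpow h0 h1 (by positivity : 0 ≤ 1/q)
      rw [← Real.rpow_mul (by positivity), mul_one_div_cancel q0.ne', Real.rpow_one] at h2
      nlinarith [sq_nonneg (v1 * R)]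
  refine LHS.trans ?_
  simp only [Nat.cast_one, mul_one, Real.one_rpow]
  have h9 : (9 * (1 + v1 ^ 2)) ≤ (9 * (1 + v1 ^ 2)) / α ^ (1/p) := by
    rw [le_div_iff₀ apos]
    exact mul_le_of_le_one_right (by positivity) apow
  calc (1 + v1 ^ 2) * R ^ 2 = 9 * (1 + v1 ^ 2) * (R/3) * (R/3) := by ring
    _ ≤ _ := by
      have M0 : 0 ≤ Mstar K := Mstar_nonneg hK.1 (body_zero hK)
      gcongr

/-- variance estimate in an arbitrary position. -/
theorem p_convex_variance_estimate :
    ∃ C' > (0 : ℝ),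
      ∀ (n : ℕ) (K : Set (E n)) (p α L : ℝ), 0 < α → 0 < L →
        IsPConvexBody K p α → IsIsotropic K L →
        ∀ q : ℝ, q = p / (p - 1) →
          ∀ T : E n →ₗ[ℝ] E n, LinearMap.det T = 1 →
            varq (T '' K) q (fun x => ‖x‖ ^ 2) ^ ((1 : ℝ) / q) ≤
              C' / (α * n) ^ (1 / p) * (n : ℝ) ^ ((3 : ℝ) / 4) *
                Mstar ((LinearMap.adjoint T ∘ₗ T) '' K) * L := by
  have hc := c0_pos
  have A0 : 0 ≤ 88000 * √(1 + 8*(6+c0)) := by positivity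
  have B0 : 0 < 9 * (1 + v1 ^ 2) := by positivity
  refine ⟨88000 * √(1 + 8*(6+c0)) + 9 * (1 + v1 ^ 2), by linarith, ?_⟩
  intro n K p α L hα hL hP hI q hq T hT
  subst hq
  have hn := n_pos hα hP
  have hn' : (0:ℝ) < n := by exact_mod_cast hn
  have M0 : 0 ≤ Mstar ((LinearMap.adjoint T ∘ₗ T) '' K) :=
    Mstar_nonneg (hP.1.1.image (LinearMap.continuous_of_finiteDimensional _))
      ⟨0, body_zero hP.1, map_zero _⟩
  have key : ∀ c d : ℝ, c ≤ d → c / (α * n) ^ (1 / p) * (n : ℝ) ^ ((3 : ℝ) / 4) *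
      Mstar ((LinearMap.adjoint T ∘ₗ T) '' K) * L ≤ d / (α * n) ^ (1 / p) * (n : ℝ) ^ ((3 : ℝ) / 4) *
      Mstar ((LinearMap.adjoint T ∘ₗ T) '' K) * L := by
    intro c d h
    have hz : 0 < (α * n) ^ (1/p) := by positivity
    have h1 := div_le_div_of_nonneg_right h hz.le
    have h2 : 0 ≤ (n : ℝ) ^ ((3 : ℝ) / 4) := by positivity
    exact mul_le_mul_of_nonneg_right (mul_le_mul_of_nonneg_right
      (mul_le_mul_of_nonneg_right h1 h2) M0) hL.le
  by_cases hp : 2 ≤ p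
  · exact (main_p2 hn hα hL hp hP hI T hT).trans (key _ _ (by linarith))
  · have h1 : n = 1 := by
      by_contra h
      exact hp (p_ge_two (by omega) hα hP)
    subst h1
    push Not at hp
    exact (main_n1 hα hL (p_ge_one hα hP) hp hP hI T hT).trans (key _ _ (by linarith))

end GM
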